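/- arXiv:1204.4776 — 12 statements merged into one kernel-verified Lean document; each statement's English description precedes it below -/
import Mathlib

section
/- For every interval I of the alphabet A and all words u, v ∈ A*, u ≡_B v implies u|_I ≡_B v|_I. (The Baxter monoid is compatible with the restriction of alphabet intervals.) -/
/-- The Baxter congruence on words over a totally ordered alphabet. -/
inductive BaxterEquiv {A : Type*} [LinearOrder A] : List A → List A → Prop
  | refl (u : List A) : BaxterEquiv u u
  | symm {u v : List A} : BaxterEquiv u v → BaxterEquiv v u
  | trans {u v w : List A} : BaxterEquiv u v → BaxterEquiv v w → BaxterEquiv u w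
  | rel1 (x u v y : List A) (a b c d : A) (hab : a ≤ b) (hbc : b < c) (hcd : c ≤ d) :
      BaxterEquiv (x ++ c :: u ++ a :: d :: v ++ b :: y)
                  (x ++ c :: u ++ d :: a :: v ++ b :: y)
  | rel2 (x u v y : List A) (a b c d : A) (hab : a < b) (hbc : b ≤ c) (hcd : c < d) :
      BaxterEquiv (x ++ b :: u ++ d :: a :: v ++ c :: y)
                  (x ++ b :: u ++ a :: d :: v ++ c :: y)

/-- The Baxter monoid is compatible with the restriction of
alphabet intervals: for every interval `I` of `A` and all words `u`, `v`,
`u ≡_B v` implies `u|_I ≡_B v|_I`, where `u|_I` is the longest subword of `u`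
with letters in `I`. -/
theorem baxterEquiv_restrict_interval {A : Type*} [LinearOrder A]
    (I : Set A) [DecidablePred (· ∈ I)]
    (hI : ∀ a b c : A, a ∈ I → c ∈ I → a ≤ b → b ≤ c → b ∈ I)
    (u v : List A) (h : BaxterEquiv u v) :
    BaxterEquiv (u.filter (fun a => decide (a ∈ I))) (v.filter (fun a => decide (a ∈ I))) := by
  induction h with
  | refl u => exact .refl _
  | symm _ ih => exact ih.symm
  | trans _ _ ih₁ ih₂ => exact ih₁.trans ih₂
  | rel1 x u v y a b c d hab hbc hcd =>
    by_cases ha : a ∈ I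
    · by_cases hd : d ∈ I
      · have hb : b ∈ I := hI a b d ha hd hab (hbc.le.trans hcd)
        have hc : c ∈ I := hI a c d ha hd (hab.trans hbc.le) hcd
        simpa [List.filter_cons, ha, hb, hc, hd] using
          BaxterEquiv.rel1 (x.filter (· ∈ I)) (u.filter (· ∈ I)) (v.filter (· ∈ I))
            (y.filter (· ∈ I)) a b c d hab hbc hcd
      · simpa [List.filter_cons, hd] using BaxterEquiv.refl _
    · simpa [List.filter_cons, ha] using BaxterEquiv.refl _
  | rel2 x u v y a b c d hab hbc hcd =>
    by_cases ha : a ∈ I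
    · by_cases hd : d ∈ I
      · have hb : b ∈ I := hI a b d ha hd hab.le (hbc.trans hcd.le)
        have hc : c ∈ I := hI a c d ha hd (hab.le.trans hbc) hcd.le
        simpa [List.filter_cons, ha, hb, hc, hd] using
          BaxterEquiv.rel2 (x.filter (· ∈ I)) (u.filter (· ∈ I)) (v.filter (· ∈ I))
            (y.filter (· ∈ I)) a b c d hab hbc hcd
      · simpa [List.filter_cons, hd] using BaxterEquiv.refl _
    · simpa [List.filter_cons, ha] using BaxterEquiv.refl _
end

section
/- For all words u, v over ℤ, u ≡_B v implies u^# ≡_B v^#. (The Baxter monoid is compatible with the Schützenberger involution.) -/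
/-- The Schützenberger transform of a word over `ℤ`: reverse the word and negate
each letter. -/
def sharp (u : List ℤ) : List ℤ := (u.map (fun a => -a)).reverse

/-- The Baxter monoid is compatible with the Schützenberger
involution: `u ≡_B v` implies `u^# ≡_B v^#`. -/
theorem baxterEquiv_sharp (u v : List ℤ) (h : BaxterEquiv u v) :
    BaxterEquiv (sharp u) (sharp v) := by
  induction h with
  | refl u => exact .refl _
  | symm _ ih => exact ih.symm
  | trans _ _ ih₁ ih₂ => exact ih₁.trans ih₂
  | rel1 x u v y a b c d hab hbc hcd =>
    simpa [sharp] using BaxterEquiv.rel1 (sharp y) (sharp v) (sharp u) (sharp x)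
      (-d) (-c) (-b) (-a) (neg_le_neg hcd) (neg_lt_neg hbc) (neg_le_neg hab)
  | rel2 x u v y a b c d hab hbc hcd =>
    simpa [sharp] using BaxterEquiv.rel2 (sharp y) (sharp v) (sharp u) (sharp x)
      (-d) (-c) (-b) (-a) (neg_lt_neg hcd) (neg_le_neg hbc) (neg_lt_neg hab)
end

section
/- Let u = x·a·c·y and v = x·c·a·y be words over A, where x and y are words and a < c are letters, and suppose u ≡_S v. Then there exists a letter b occurring in y with a ≤ b < c; in particular, u and v are related by a single application of the sylvester adjacency relation. -/
/-- The sylvester congruence on words over a totally ordered alphabet: the monoid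
congruence generated by the adjacency relation `a·c·u·b ≡ c·a·u·b` for `a ≤ b < c`. -/
inductive SylvEquiv {A : Type*} [LinearOrder A] : List A → List A → Prop
  | refl (u : List A) : SylvEquiv u u
  | symm {u v : List A} : SylvEquiv u v → SylvEquiv v u
  | trans {u v w : List A} : SylvEquiv u v → SylvEquiv v w → SylvEquiv u w
  | rel (x w y : List A) (a b c : A) (hab : a ≤ b) (hbc : b < c) :
      SylvEquiv (x ++ a :: c :: w ++ b :: y) (x ++ c :: a :: w ++ b :: y)

/-- `u` and `v` are related by a single application of the sylvester adjacency
relation (in some context). -/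
def SylvAdj {A : Type*} [LinearOrder A] (u v : List A) : Prop :=
  ∃ (x w y : List A) (a b c : A), a ≤ b ∧ b < c ∧
    u = x ++ a :: c :: w ++ b :: y ∧ v = x ++ c :: a :: w ++ b :: y

/-- A letter failing `p` screens `List.takeWhile p` from everything behind it. -/
theorem takeWhile_append_cons_of_neg {α : Type*} (p : α → Bool) (l m n : List α) (b : α)
    (hb : p b = false) :
    (l ++ b :: m).takeWhile p = (l ++ b :: n).takeWhile p := by
  simp [List.takeWhile_append, hb]

/-- The sylvester congruence preserves the block of letters `c` that ends the restriction of a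
word to the interval `[a, c]`. -/
theorem SylvEquiv.takeWhile_reverse_filter_eq {A : Type*} [LinearOrder A] {u v : List A}
    (h : SylvEquiv u v) (a c : A) :
    ((u.filter (fun t => a ≤ t ∧ t ≤ c)).reverse).takeWhile (fun t => t = c) =
      ((v.filter (fun t => a ≤ t ∧ t ≤ c)).reverse).takeWhile (fun t => t = c) := by
  induction h with
  | refl u => rfl
  | symm _ ih => exact ih.symm
  | trans _ _ ih₁ ih₂ => exact ih₁.trans ih₂
  | rel x w y p b q hpb hbq =>
    by_cases hpq : a ≤ p ∧ q ≤ c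
    · obtain ⟨hp, hq⟩ := hpq
      have hb : a ≤ b ∧ b ≤ c := ⟨hp.trans hpb, (hbq.trans_le hq).le⟩
      rw [List.filter_append _ (b :: y), List.filter_append _ (b :: y),
        List.filter_cons_of_pos (by simpa using hb)]
      simp only [List.reverse_append, List.reverse_cons, List.append_assoc, List.cons_append,
        List.nil_append]
      exact takeWhile_append_cons_of_neg _ _ _ _ _ (decide_eq_false (hbq.trans_le hq).ne)
    · have hswap : [p, q].filter (fun t => a ≤ t ∧ t ≤ c) =
          [q, p].filter (fun t => a ≤ t ∧ t ≤ c) := by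
        have : p < q := hpb.trans_lt hbq
        simp only [List.filter_cons, List.filter_nil, decide_eq_true_eq]
        grind
      have split : ∀ s t : A, x ++ s :: t :: w ++ b :: y = x ++ ([s, t] ++ (w ++ b :: y)) := by
        simp
      simp only [split, List.filter_append, hswap]

/-- If `u = x·a·c·y` and `v = x·c·a·y` with `a < c` and `u ≡_S v`,
then some letter `b` with `a ≤ b < c` occurs in `y`; in particular `u` and `v` are
related by a single application of the sylvester adjacency relation. -/
theorem sylvEquiv_adjacent {A : Type*} [LinearOrder A]
    (x y : List A) (a c : A) (hac : a < c)
    (h : SylvEquiv (x ++ a :: c :: y) (x ++ c :: a :: y)) :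
    (∃ b ∈ y, a ≤ b ∧ b < c) ∧
      SylvAdj (x ++ a :: c :: y) (x ++ c :: a :: y) := by
  have hb : ∃ b ∈ y, a ≤ b ∧ b < c := by
    by_contra! hy
    have htail : ∀ t ∈ (y.filter (fun t => a ≤ t ∧ t ≤ c)).reverse, decide (t = c) = true := by
      intro t ht
      simp only [List.mem_reverse, List.mem_filter, decide_eq_true_eq] at ht ⊢
      exact le_antisymm ht.2.2 (hy t ht.1 ht.2.1)
    have key := h.takeWhile_reverse_filter_eq a c
    simp only [Bool.decide_and] at htail
    simp [hac.le] at key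
    simp [List.takeWhile_append_of_pos htail, hac.ne] at key
  refine ⟨hb, ?_⟩
  obtain ⟨b, hby, hab, hbc⟩ := hb
  obtain ⟨w, z, rfl⟩ := List.append_of_mem hby
  exact ⟨x, w, z, a, b, c, hab, hbc, by simp, by simp⟩
end

section
/- For all words u, v ∈ A*, one has u ≡_B v if and only if u ≡_S v and u ≡_{S#} v. -/
/-- The `#`-sylvester congruence: generated by `b·u·a·c ≡ b·u·c·a` for `a < b ≤ c`. -/
inductive SylvSharpEquiv {A : Type*} [LinearOrder A] : List A → List A → Prop
  | refl (u : List A) : SylvSharpEquiv u u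
  | symm {u v : List A} : SylvSharpEquiv u v → SylvSharpEquiv v u
  | trans {u v w : List A} : SylvSharpEquiv u v → SylvSharpEquiv v w → SylvSharpEquiv u w
  | rel (x w y : List A) (a b c : A) (hab : a < b) (hbc : b ≤ c) :
      SylvSharpEquiv (x ++ b :: w ++ a :: c :: y) (x ++ b :: w ++ c :: a :: y)

section LastReset

variable {A : Type*} [DecidableEq A] (P : A → Prop) [DecidablePred P] (t : A)

/-- One step of the scan computing `lastReset`. -/
def resetStep (st : Option A × ℕ) (e : A) : Option A × ℕ :=
  if P e then (some e, 0) else if e = t then (st.1, st.2 + 1) else st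

/-- The last letter of a word satisfying `P` (if any), with the number of `t`s following it. -/
def lastReset (w : List A) : Option A × ℕ :=
  w.foldl (resetStep P t) (none, 0)

variable {P t}

lemma lastReset_append_singleton (w : List A) (e : A) :
    lastReset P t (w ++ [e]) = resetStep P t (lastReset P t w) e := by
  simp [lastReset]

lemma lastReset_append_of_forall_not (p s : List A) (hs : ∀ e ∈ s, ¬ P e) :
    lastReset P t (p ++ s) = ((lastReset P t p).1, (lastReset P t p).2 + s.count t) := by
  induction s using List.reverseRecOn with
  | nil => simp
  | append_singleton s e ih =>
    have he : ¬ P e := hs e (by simp)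
    rw [← List.append_assoc, lastReset_append_singleton, ih fun f hf => hs f (by simp [hf])]
    by_cases h : e = t
    · subst h
      simp [resetStep, he, add_assoc]
    · simp [resetStep, he, h]

lemma lastReset_append_cons (p s : List A) {e : A} (he : P e) (hs : ∀ f ∈ s, ¬ P f) :
    lastReset P t (p ++ e :: s) = (some e, s.count t) := by
  rw [List.append_cons, lastReset_append_of_forall_not _ _ hs, lastReset_append_singleton]
  simp [resetStep, he]

lemma exists_lastReset_append (p s : List A) (hs : ∃ e ∈ s, P e) :
    ∃ e ∈ s, (lastReset P t (p ++ s)).1 = some e ∧ (lastReset P t (p ++ s)).2 ≤ s.count t := by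
  induction s using List.reverseRecOn with
  | nil => simp at hs
  | append_singleton s e ih =>
    rw [← List.append_assoc, lastReset_append_singleton]
    by_cases he : P e
    · exact ⟨e, by simp, by simp [resetStep, he]⟩
    · obtain ⟨f, hf, hP⟩ := hs
      have hfs : f ∈ s := by
        rcases List.mem_append.1 hf with h | h
        · exact h
        · exact absurd (List.mem_singleton.1 h ▸ hP) he
      obtain ⟨g, hg, h1, h2⟩ := ih ⟨f, hfs, hP⟩
      refine ⟨g, by simp [hg], ?_⟩
      by_cases h : e = t
      · subst h
        simp [resetStep, he, h1, h2]
      · simp [resetStep, he, h, h1, h2]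

lemma lastReset_swap (x w y : List A) (e f g : A)
    (h : (P e ∨ e = t) → (P f ∨ f = t) → P g) :
    lastReset P t (x ++ e :: f :: w ++ g :: y) = lastReset P t (x ++ f :: e :: w ++ g :: y) := by
  by_cases hg : P g
  · simp [lastReset, resetStep, hg]
  · have hc (st : Option A × ℕ) :
        resetStep P t (resetStep P t st e) f = resetStep P t (resetStep P t st f) e := by
      unfold resetStep
      grind
    simp [lastReset, hc]

end LastReset

section Invariants

variable {A : Type*} [LinearOrder A] {u v : List A}

lemma SylvEquiv.perm (h : SylvEquiv u v) : u.Perm v := by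
  induction h with
  | refl => exact .refl _
  | symm _ ih => exact ih.symm
  | trans _ _ ih₁ ih₂ => exact ih₁.trans ih₂
  | rel x w y a b c =>
    exact ((List.Perm.swap c a w).append_left x).append_right _

lemma SylvEquiv.lastReset_eq (h : SylvEquiv u v) (a d : A) :
    lastReset (fun e => a ≤ e ∧ e < d) d u = lastReset (fun e => a ≤ e ∧ e < d) d v := by
  induction h with
  | refl => rfl
  | symm _ ih => exact ih.symm
  | trans _ _ ih₁ ih₂ => exact ih₁.trans ih₂
  | rel x w y a' b c hab hbc =>
    refine lastReset_swap x w y a' c b fun h₁ h₂ => ?_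
    grind

lemma SylvSharpEquiv.lastReset_reverse_eq (h : SylvSharpEquiv u v) (a d : A) :
    lastReset (fun e => a < e ∧ e ≤ d) a u.reverse =
      lastReset (fun e => a < e ∧ e ≤ d) a v.reverse := by
  induction h with
  | refl => rfl
  | symm _ ih => exact ih.symm
  | trans _ _ ih₁ ih₂ => exact ih₁.trans ih₂
  | rel x w y a' b c hab hbc =>
    have := lastReset_swap (P := fun e => a < e ∧ e ≤ d) (t := a)
      y.reverse w.reverse x.reverse c a' b (fun h₁ h₂ => by grind)
    simpa using this

end Invariants

section Baxter

variable {A : Type*} [LinearOrder A] {u v : List A}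

lemma BaxterEquiv.sylvEquiv (h : BaxterEquiv u v) : SylvEquiv u v := by
  induction h with
  | refl => exact .refl _
  | symm _ ih => exact ih.symm
  | trans _ _ ih₁ ih₂ => exact ih₁.trans ih₂
  | rel1 x u v y a b c d hab hbc hcd =>
    simpa using SylvEquiv.rel (x ++ c :: u) v y a b d hab (hbc.trans_le hcd)
  | rel2 x u v y a b c d hab hbc hcd =>
    simpa using (SylvEquiv.rel (x ++ b :: u) v y a c d (hab.le.trans hbc) hcd).symm

lemma BaxterEquiv.sylvSharpEquiv (h : BaxterEquiv u v) : SylvSharpEquiv u v := by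
  induction h with
  | refl => exact .refl _
  | symm _ ih => exact ih.symm
  | trans _ _ ih₁ ih₂ => exact ih₁.trans ih₂
  | rel1 x u v y a b c d hab hbc hcd =>
    simpa using SylvSharpEquiv.rel x u (v ++ b :: y) a c d (hab.trans_lt hbc) hcd
  | rel2 x u v y a b c d hab hbc hcd =>
    simpa using (SylvSharpEquiv.rel x u (v ++ c :: y) a b d hab (hbc.trans hcd.le)).symm

/-- Adjacent letters `a < d` commute in the presence of a suitable earlier letter and a suitable
later letter. -/
lemma BaxterEquiv.swap_of_exists {x y : List A} {a d : A}
    (hx : ∃ e ∈ x, a < e ∧ e ≤ d) (hy : ∃ e ∈ y, a ≤ e ∧ e < d) :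
    BaxterEquiv (x ++ a :: d :: y) (x ++ d :: a :: y) := by
  obtain ⟨e, he, hae, hed⟩ := hx
  obtain ⟨f, hf, haf, hfd⟩ := hy
  obtain ⟨x₁, x₂, rfl⟩ := List.append_of_mem he
  obtain ⟨y₁, y₂, rfl⟩ := List.append_of_mem hf
  rcases lt_or_ge f e with h | h
  · simpa using BaxterEquiv.rel1 x₁ x₂ y₁ y₂ a f e d haf h hed
  · simpa using (BaxterEquiv.rel2 x₁ x₂ y₁ y₂ a e f d hae h hfd).symm

/-- If `v` reads `y` right after `p` while `u` reads the letters `s` and `z` in between, then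
`z` and `y` may be exchanged in `u`. -/
lemma BaxterEquiv.swap_of_sylv_of_sylvSharp {p s t w : List A} {y z : A}
    (hy : y ∉ s) (hzy : z ≠ y)
    (hS : SylvEquiv (p ++ s ++ z :: y :: t) (p ++ y :: w))
    (hT : SylvSharpEquiv (p ++ s ++ z :: y :: t) (p ++ y :: w)) :
    BaxterEquiv (p ++ s ++ z :: y :: t) (p ++ s ++ y :: z :: t) := by
  have hcy : w.count y = t.count y := by
    have := hS.perm.count_eq y
    simp [hzy, List.count_eq_zero_of_not_mem hy] at this
    omega
  have hcz : w.count z = s.count z + t.count z + 1 := by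
    have := hS.perm.count_eq z
    simp [hzy.symm] at this
    omega
  have hzw : z ∈ w := List.count_pos_iff.1 (by omega)
  rcases lt_or_gt_of_ne hzy with hlt | hlt
  · refine BaxterEquiv.swap_of_exists ?_ ?_
    · by_contra! hn
      have hn' : ∀ e ∈ p ++ s, ¬ (z < e ∧ e ≤ y) := fun e he h => (hn e he h.1).not_ge h.2
      have h := hT.lastReset_reverse_eq z y
      have h₁ : (p ++ s ++ z :: y :: t).reverse =
          t.reverse ++ y :: (z :: (s.reverse ++ p.reverse)) := by simp
      have h₂ : (p ++ y :: w).reverse = w.reverse ++ y :: p.reverse := by simp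
      rw [h₁, h₂, lastReset_append_cons _ _ ⟨hlt, le_rfl⟩ (by grind),
        lastReset_append_cons _ _ ⟨hlt, le_rfl⟩ (by grind)] at h
      simp at h
      omega
    · by_contra! hn
      have h := hS.lastReset_eq z y
      have h₁ : p ++ y :: w = (p ++ [y]) ++ w := by simp
      obtain ⟨e, -, -, he⟩ := exists_lastReset_append (P := fun e => z ≤ e ∧ e < y) (t := y)
        (p ++ [y]) w ⟨z, hzw, le_rfl, hlt⟩
      rw [h₁, lastReset_append_cons _ _ ⟨le_rfl, hlt⟩ (by grind)] at h
      rw [← h] at he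
      simp at he
      omega
  · refine (BaxterEquiv.swap_of_exists ?_ ?_).symm
    · by_contra! hn
      have h := hT.lastReset_reverse_eq y z
      have h₁ : (p ++ s ++ z :: y :: t).reverse =
          (t.reverse ++ [y]) ++ z :: (s.reverse ++ p.reverse) := by simp
      have h₂ : (p ++ y :: w).reverse = w.reverse ++ (y :: p.reverse) := by simp
      rw [h₁, h₂, lastReset_append_cons _ _ ⟨hlt, le_rfl⟩ (by grind),
        lastReset_append_of_forall_not _ _ (by grind)] at h
      simp [List.count_eq_zero_of_not_mem hy] at h
      omega
    · by_contra! hn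
      have hyt : y ∉ t := fun h => (hn y h le_rfl).not_gt hlt
      have hyw : y ∉ w := List.count_eq_zero.1 (hcy.trans (List.count_eq_zero_of_not_mem hyt))
      have h := hS.lastReset_eq y z
      have h₁ : p ++ s ++ z :: y :: t = (p ++ s ++ [z]) ++ y :: t := by simp
      rw [h₁, lastReset_append_cons _ _ ⟨le_rfl, hlt⟩ (by grind)] at h
      by_cases hw : ∃ e ∈ w, y ≤ e ∧ e < z
      · obtain ⟨e, hew, he, -⟩ := exists_lastReset_append (t := z) (p ++ [y]) w hw
        rw [← List.append_cons, ← h] at he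
        exact hyw (Option.some.inj he ▸ hew)
      · push Not at hw
        rw [lastReset_append_cons _ _ ⟨le_rfl, hlt⟩ (by grind)] at h
        simp at h
        omega

lemma BaxterEquiv.move_left {p s t w : List A} {y : A} (hy : y ∉ s)
    (hS : SylvEquiv (p ++ s ++ y :: t) (p ++ y :: w))
    (hT : SylvSharpEquiv (p ++ s ++ y :: t) (p ++ y :: w)) :
    BaxterEquiv (p ++ s ++ y :: t) (p ++ y :: (s ++ t)) := by
  induction s using List.reverseRecOn generalizing t with
  | nil => simpa using BaxterEquiv.refl _
  | append_singleton s z ih =>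
    simp only [List.mem_append, List.mem_singleton, not_or] at hy
    have h₁ : p ++ (s ++ [z]) ++ y :: t = p ++ s ++ z :: y :: t := by simp
    rw [h₁] at hS hT ⊢
    have h := BaxterEquiv.swap_of_sylv_of_sylvSharp hy.1 (Ne.symm hy.2) hS hT
    simpa using h.trans (ih hy.1 (h.sylvEquiv.symm.trans hS) (h.sylvSharpEquiv.symm.trans hT))

lemma BaxterEquiv.of_sylv_of_sylvSharp_append (p u v : List A)
    (hS : SylvEquiv (p ++ u) (p ++ v)) (hT : SylvSharpEquiv (p ++ u) (p ++ v)) :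
    BaxterEquiv (p ++ u) (p ++ v) := by
  induction v generalizing p u with
  | nil =>
    rw [((List.perm_append_left_iff p).1 hS.perm).eq_nil]
    exact .refl _
  | cons y w ih =>
    have hyu : y ∈ u := ((List.perm_append_left_iff p).1 hS.perm).mem_iff.2 (by simp)
    obtain ⟨s, t, rfl, hy⟩ := List.eq_append_cons_of_mem hyu
    rw [← List.append_assoc] at hS hT ⊢
    have h := BaxterEquiv.move_left hy hS hT
    have hS' := h.sylvEquiv.symm.trans hS
    have hT' := h.sylvSharpEquiv.symm.trans hT
    rw [List.append_cons, List.append_cons p y w] at hS' hT'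
    have h' := ih _ _ hS' hT'
    rw [← List.append_cons, ← List.append_cons] at h'
    exact h.trans h'

end Baxter

/-- For all words `u, v`: `u ≡_B v` iff `u ≡_S v` and `u ≡_{S#} v`. -/
theorem baxterEquiv_iff_sylv_and_sylvSharp {A : Type*} [LinearOrder A] (u v : List A) :
    BaxterEquiv u v ↔ (SylvEquiv u v ∧ SylvSharpEquiv u v) :=
  ⟨fun h => ⟨h.sylvEquiv, h.sylvSharpEquiv⟩,
    fun h => BaxterEquiv.of_sylv_of_sylvSharp_append [] u v h.1 h.2⟩
end

section
/- Let u = x·a·d·y and v = x·d·a·y be words over A, where x and y are words and a < d are letters, and suppose u ≡_B v. Then there exist a letter b occurring in x with a < b ≤ d and a letter b' occurring in y with a ≤ b' < d; in particular, u and v are related by a single application of one of the two defining Baxter adjacency relations. -/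
/-- `u` and `v` are related by a single application of one of the two defining
Baxter adjacency relations (in either direction). -/
def BaxterAdj {A : Type*} [LinearOrder A] (u v : List A) : Prop :=
  ∃ (x w z y : List A) (a b c d : A),
    (a ≤ b ∧ b < c ∧ c ≤ d ∧
      ((u = x ++ c :: w ++ a :: d :: z ++ b :: y ∧
        v = x ++ c :: w ++ d :: a :: z ++ b :: y) ∨
       (v = x ++ c :: w ++ a :: d :: z ++ b :: y ∧
        u = x ++ c :: w ++ d :: a :: z ++ b :: y))) ∨
    (a < b ∧ b ≤ c ∧ c < d ∧
      ((u = x ++ b :: w ++ d :: a :: z ++ c :: y ∧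
        v = x ++ b :: w ++ a :: d :: z ++ c :: y) ∨
       (v = x ++ b :: w ++ d :: a :: z ++ c :: y ∧
        u = x ++ b :: w ++ a :: d :: z ++ c :: y)))

/-- The maximal run of letters `a` at the start of the restriction of `w` to the interval
`[a, d]`. -/
def leadingRun {A : Type*} [LinearOrder A] (a d : A) (w : List A) : List A :=
  (w.filter (fun t => a ≤ t ∧ t ≤ d)).takeWhile (fun t => t = a)

theorem takeWhile_append_of_mem {α : Type*} {p : α → Bool} {s : List α} {e : α}
    (he : e ∈ s) (hp : p e = false) (t : List α) :
    (s ++ t).takeWhile p = s.takeWhile p := by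
  induction s with
  | nil => simp at he
  | cons c s ih =>
    cases hc : p c with
    | false => simp [hc]
    | true =>
      have hs : e ∈ s := by
        rcases List.mem_cons.1 he with rfl | h
        · simp [hc] at hp
        · exact h
      simp [hc, ih hs]

section Baxter

variable {A : Type*} [LinearOrder A]

/-- `leadingRun` is invariant under the `#`-sylvester relations. -/
theorem leadingRun_swap (a d : A) {s : List A} {a' b' d' : A} (hb : b' ∈ s)
    (hab : a' < b') (hbd : b' ≤ d') (t : List A) :
    leadingRun a d (s ++ a' :: d' :: t) = leadingRun a d (s ++ d' :: a' :: t) := by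
  unfold leadingRun
  by_cases ha : a ≤ a' ∧ a' ≤ d
  · by_cases hd : a ≤ d' ∧ d' ≤ d
    · have hmem : b' ∈ s.filter (fun t => a ≤ t ∧ t ≤ d) := by
        simpa [hb] using ⟨ha.1.trans hab.le, hbd.trans hd.2⟩
      have hne : decide (b' = a) = false := by
        simpa using (ha.1.trans_lt hab).ne'
      rw [List.filter_append, List.filter_append, takeWhile_append_of_mem hmem hne,
        takeWhile_append_of_mem hmem hne]
    · simp only [List.filter_append, List.filter_cons, hd, decide_false, Bool.false_eq_true,
        if_false]
  · simp only [List.filter_append, List.filter_cons, ha, decide_false, Bool.false_eq_true,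
      if_false]

theorem BaxterEquiv.leadingRun_eq (a d : A) {u v : List A} (h : BaxterEquiv u v) :
    leadingRun a d u = leadingRun a d v := by
  induction h with
  | refl u => rfl
  | symm _ ih => exact ih.symm
  | trans _ _ ih₁ ih₂ => exact ih₁.trans ih₂
  | rel1 x u v y a' b' c' d' hab hbc hcd =>
    simpa using leadingRun_swap a d (s := x ++ c' :: u) (b' := c') (by simp)
      (hab.trans_lt hbc) hcd (v ++ b' :: y)
  | rel2 x u v y a' b' c' d' hab hbc hcd =>
    simpa using (leadingRun_swap a d (s := x ++ b' :: u) (b' := b') (by simp)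
      hab (hbc.trans hcd.le) (v ++ c' :: y)).symm

/-- Reversing words and the order of the alphabet preserves the Baxter congruence. -/
theorem BaxterEquiv.reverse_toDual {u v : List A} (h : BaxterEquiv u v) :
    BaxterEquiv (u.map OrderDual.toDual).reverse (v.map OrderDual.toDual).reverse := by
  induction h with
  | refl u => exact .refl _
  | symm _ ih => exact ih.symm
  | trans _ _ ih₁ ih₂ => exact ih₁.trans ih₂
  | rel1 x u v y a b c d hab hbc hcd =>
    simpa using (BaxterEquiv.rel1 (y.map OrderDual.toDual).reverse
      (v.map OrderDual.toDual).reverse (u.map OrderDual.toDual).reverse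
      (x.map OrderDual.toDual).reverse (OrderDual.toDual d) (OrderDual.toDual c)
      (OrderDual.toDual b) (OrderDual.toDual a) hcd hbc hab)
  | rel2 x u v y a b c d hab hbc hcd =>
    simpa using (BaxterEquiv.rel2 (y.map OrderDual.toDual).reverse
      (v.map OrderDual.toDual).reverse (u.map OrderDual.toDual).reverse
      (x.map OrderDual.toDual).reverse (OrderDual.toDual d) (OrderDual.toDual c)
      (OrderDual.toDual b) (OrderDual.toDual a) hcd hbc hab)

theorem BaxterEquiv.exists_mem_left {x y : List A} {a d : A} (had : a < d)
    (h : BaxterEquiv (x ++ a :: d :: y) (x ++ d :: a :: y)) :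
    ∃ b ∈ x, a < b ∧ b ≤ d := by
  by_contra! hx
  have hrun : ∀ e ∈ x.filter (fun t => a ≤ t ∧ t ≤ d), decide (e = a) = true := by
    intro e he
    simp only [List.mem_filter, decide_eq_true_eq] at he ⊢
    by_contra hne
    exact (hx e he.1 (lt_of_le_of_ne he.2.1 (Ne.symm hne))).not_ge he.2.2
  have key := h.leadingRun_eq a d
  simp only [leadingRun, List.filter_append, List.takeWhile_append_of_pos hrun] at key
  simp [had.le, had.ne'] at key

theorem BaxterEquiv.exists_mem_right {x y : List A} {a d : A} (had : a < d)
    (h : BaxterEquiv (x ++ a :: d :: y) (x ++ d :: a :: y)) :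
    ∃ b ∈ y, a ≤ b ∧ b < d := by
  have h' := h.reverse_toDual
  simp only [List.map_append, List.map_cons, List.reverse_append, List.reverse_cons,
    List.append_assoc, List.cons_append, List.nil_append] at h'
  have hda : OrderDual.toDual d < OrderDual.toDual a := had
  obtain ⟨b, hb, hdb, hba⟩ := BaxterEquiv.exists_mem_left hda h'
  obtain ⟨c, hc, rfl⟩ := List.mem_map.1 (List.mem_reverse.1 hb)
  exact ⟨c, hc, hba, hdb⟩

theorem baxterAdj_of_mem {x y : List A} {a d b b' : A} (hb : b ∈ x) (hab : a < b)
    (hbd : b ≤ d) (hb' : b' ∈ y) (hab' : a ≤ b') (hbd' : b' < d) :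
    BaxterAdj (x ++ a :: d :: y) (x ++ d :: a :: y) := by
  obtain ⟨x₁, x₂, rfl⟩ := List.append_of_mem hb
  obtain ⟨y₁, y₂, rfl⟩ := List.append_of_mem hb'
  rcases lt_or_ge b' b with hlt | hle
  · exact ⟨x₁, x₂, y₁, y₂, a, b', b, d, .inl ⟨hab', hlt, hbd, .inl (by simp)⟩⟩
  · exact ⟨x₁, x₂, y₁, y₂, a, b, b', d, .inr ⟨hab, hle, hbd', .inr (by simp)⟩⟩

end Baxter

/-- If `u = x·a·d·y` and `v = x·d·a·y` with `a < d` and `u ≡_B v`,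
then some letter `b` with `a < b ≤ d` occurs in `x` and some letter `b'` with
`a ≤ b' < d` occurs in `y`; in particular `u` and `v` are related by a single
application of one of the two defining Baxter adjacency relations. -/
theorem baxterEquiv_adjacent {A : Type*} [LinearOrder A]
    (x y : List A) (a d : A) (had : a < d)
    (h : BaxterEquiv (x ++ a :: d :: y) (x ++ d :: a :: y)) :
    (∃ b ∈ x, a < b ∧ b ≤ d) ∧ (∃ b' ∈ y, a ≤ b' ∧ b' < d) ∧
      BaxterAdj (x ++ a :: d :: y) (x ++ d :: a :: y) := by
  obtain ⟨b, hb, hab, hbd⟩ := h.exists_mem_left had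
  obtain ⟨b', hb', hab', hbd'⟩ := h.exists_mem_right had
  exact ⟨⟨b, hb, hab, hbd⟩, ⟨b', hb', hab', hbd'⟩,
    baxterAdj_of_mem hb hab hbd hb' hab' hbd'⟩
end

section
/- For all permutations σ and ν of size n, σ ≡_B ν implies σ ≡_{R_3} ν; consequently, each equivalence class of permutations under the 3-recoil congruence ≡_{R_3} is a union of ≡_B-equivalence classes. -/
/-- The `k`-recoil congruence on words over the alphabet `ℕ`: the monoid congruence
generated by `a·b ≡ b·a` whenever `b − a ≥ k` (the number of letters `x ∈ ℕ` with
`a < x ≤ b` being `b − a`). -/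
inductive RecoilEquiv (k : ℕ) : List ℕ → List ℕ → Prop
  | refl (u : List ℕ) : RecoilEquiv k u u
  | symm {u v : List ℕ} : RecoilEquiv k u v → RecoilEquiv k v u
  | trans {u v w : List ℕ} : RecoilEquiv k u v → RecoilEquiv k v w → RecoilEquiv k u w
  | rel (x y : List ℕ) (a b : ℕ) (h : a + k ≤ b) :
      RecoilEquiv k (x ++ a :: b :: y) (x ++ b :: a :: y)

/-- `σ` is a permutation of size `n`, viewed as a word. -/
def IsPermWord (n : ℕ) (σ : List ℕ) : Prop :=
  σ.Perm ((List.range n).map (· + 1))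

/-- Baxter-congruent words are rearrangements of each other. -/
theorem BaxterEquiv.perm {A : Type*} [LinearOrder A] {u v : List A} (h : BaxterEquiv u v) :
    u.Perm v := by
  induction h with
  | refl u => exact .refl u
  | symm _ ih => exact ih.symm
  | trans _ _ ih₁ ih₂ => exact ih₁.trans ih₂
  | rel1 x u v y a b c d =>
    simpa only [List.append_assoc, List.cons_append] using
      (List.Perm.swap d a (v ++ b :: y)).append_left (x ++ c :: u)
  | rel2 x u v y a b c d =>
    simpa only [List.append_assoc, List.cons_append] using
      (List.Perm.swap a d (v ++ c :: y)).append_left (x ++ b :: u)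

/-- On words without repeated letters, the Baxter congruence refines the 3-recoil congruence. -/
theorem BaxterEquiv.recoilEquiv_of_nodup {u v : List ℕ} (h : BaxterEquiv u v) (hu : u.Nodup) :
    RecoilEquiv 3 u v := by
  induction h with
  | refl u => exact .refl u
  | symm h ih => exact (ih (h.perm.nodup_iff.mpr hu)).symm
  | trans h _ ih₁ ih₂ => exact (ih₁ hu).trans (ih₂ (h.perm.nodup_iff.mp hu))
  | rel1 x u v y a b c d hab hbc hcd =>
    have hne : a ≠ b ∧ c ≠ d := by
      constructor <;> rintro rfl <;> simp [List.nodup_append] at hu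
    have had : a + 3 ≤ d := by omega
    simpa using RecoilEquiv.rel (x ++ c :: u) (v ++ b :: y) a d had
  | rel2 x u v y a b c d hab hbc hcd =>
    have hne : b ≠ c := by
      rintro rfl
      simp [List.nodup_append] at hu
    have had : a + 3 ≤ d := by omega
    simpa using (RecoilEquiv.rel (x ++ b :: u) (v ++ c :: y) a d had).symm

/-- For permutations `σ`, `ν` of size `n`, `σ ≡_B ν` implies
`σ ≡_{R_3} ν`; consequently each `≡_{R_3}`-class of permutations is a union of
`≡_B`-classes. -/
theorem baxterEquiv_imp_recoil3 (n : ℕ) (σ ν : List ℕ)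
    (hσ : IsPermWord n σ) (hν : IsPermWord n ν) (h : BaxterEquiv σ ν) :
    RecoilEquiv 3 σ ν := by
  refine h.recoilEquiv_of_nodup (hσ.nodup_iff.mpr ?_)
  exact List.nodup_range.map (add_left_injective 1)
end

section
/- Let T be a non-empty binary tree and let y be the i-th leaf of T in inorder. If y is left-oriented, then y is attached to the i-th node of T; if y is right-oriented, then y is attached to the (i−1)-st node of T. -/
/-- (Unlabeled) binary trees: a binary tree is either a leaf (the empty tree) or a
node with a left and a right subtree. -/
inductive BTree : Type
  | leaf : BTree
  | node : BTree → BTree → BTree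

namespace BTree

/-- Number of (internal) nodes. -/
def size : BTree → ℕ
  | leaf => 0
  | node l r => size l + size r + 1

/-- Is this tree the empty tree (a single leaf)? -/
def isLeaf : BTree → Bool
  | leaf => true
  | node _ _ => false

/-- For a binary tree whose nodes to the left have already been counted by the
offset `o`, the list over the leaves of the tree, in inorder, of pairs
`(orientation, parent)`: `orientation` is `true` if the leaf is left-oriented
(the left child of its parent) and `false` if right-oriented, and `parent` is the
1-based inorder index of the node to which the leaf is attached (in the whole
tree, given the offset `o`). -/
def leafInfo : BTree → ℕ → List (Bool × ℕ)
  | leaf, _ => []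
  | node l r, o =>
      (if l.isLeaf then [(true, o + 1)] else l.leafInfo o) ++
      (if r.isLeaf then [(false, o + l.size + 1)] else r.leafInfo (o + l.size + 1))

end BTree

namespace BTree

theorem length_leafInfo {T : BTree} (hT : T ≠ leaf) (o : ℕ) :
    (T.leafInfo o).length = T.size + 1 := by
  induction T generalizing o with
  | leaf => exact absurd rfl hT
  | node l r ihl ihr =>
    have hl : (if l.isLeaf then [(true, o + 1)] else l.leafInfo o).length = l.size + 1 := by
      cases l with
      | leaf => rfl
      | node a b => exact ihl (by simp) o
    have hr : (if r.isLeaf then [(false, o + l.size + 1)]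
        else r.leafInfo (o + l.size + 1)).length = r.size + 1 := by
      cases r with
      | leaf => rfl
      | node a b => exact ihr (by simp) _
    rw [leafInfo, List.length_append, hl, hr, size]
    omega

theorem leafInfo_getElem?_eq_some {T : BTree} {o k parent : ℕ} {orient : Bool}
    (h : (T.leafInfo o)[k]? = some (orient, parent)) :
    parent = o + k + if orient then 1 else 0 := by
  induction T generalizing o k with
  | leaf => simp [leafInfo] at h
  | node l r ihl ihr =>
    have hlen : (if l.isLeaf then [(true, o + 1)] else l.leafInfo o).length = l.size + 1 := by
      cases l with
      | leaf => rfl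
      | node a b => exact length_leafInfo (by simp) o
    rw [leafInfo, List.getElem?_append, hlen] at h
    split at h
    · split at h
      · rw [List.getElem?_singleton] at h
        split at h
        · simp only [Option.some.injEq, Prod.mk.injEq] at h
          obtain ⟨rfl, rfl⟩ := h
          simp
          omega
        · simp at h
      · exact ihl h
    · split at h
      · rw [List.getElem?_singleton] at h
        split at h
        · simp only [Option.some.injEq, Prod.mk.injEq] at h
          obtain ⟨rfl, rfl⟩ := h
          simp
          omega
        · simp at h
      · have := ihr h
        omega

end BTree

/-- Let `T` be a non-empty binary tree and `y` its `i`-th leaf in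
inorder (here `i = k + 1` where `k` is the 0-based position in `leafInfo`). If `y`
is left-oriented it is attached to the `i`-th node of `T`, and if `y` is
right-oriented it is attached to the `(i−1)`-st node of `T`. -/
theorem leaf_orientation_parent (T : BTree) (hT : T ≠ BTree.leaf)
    (k : ℕ) (orient : Bool) (parent : ℕ)
    (h : (T.leafInfo 0)[k]? = some (orient, parent)) :
    (orient = true → parent = k + 1) ∧ (orient = false → parent = k) := by
  have := BTree.leafInfo_getElem?_eq_some h
  cases orient <;> simpa using this
end

section
/- For any word u ∈ A*, writing P(u) = (T_L, T_R) for its Baxter P-symbol: T_L is a left binary search tree, T_R is a right binary search tree, the inorder readings of T_L and of T_R both equal the nondecreasing rearrangement of u, and the underlying unlabeled trees (sh(T_L), sh(T_R)) form a pair of twin binary trees. -/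
namespace BTree

/-- Orientations of all leaves in inorder: `true` = left-oriented, `false` =
right-oriented. -/
def orients : BTree → List Bool
  | leaf => []
  | node l r =>
      (if l.isLeaf then [true] else orients l) ++
      (if r.isLeaf then [false] else orients r)

/-- The canopy: orientations of the leaves, from left to right, excluding the
first and the last leaf (`true` = left-oriented ~ letter 1, `false` =
right-oriented ~ letter 0). -/
def canopy (t : BTree) : List Bool := (t.orients.drop 1).dropLast

end BTree

/-- A pair of twin binary trees: two binary trees with the same number of nodes
and complementary canopies. -/
def TwinPair (L R : BTree) : Prop :=
  L.size = R.size ∧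
  ∀ (i : ℕ) (b b' : Bool), L.canopy[i]? = some b → R.canopy[i]? = some b' → b ≠ b'

/-- Labeled binary trees over `A`. -/
inductive LTree (A : Type*) : Type _
  | leaf : LTree A
  | node : LTree A → A → LTree A → LTree A

namespace LTree

variable {A : Type*}

/-- The inorder reading of a labeled binary tree. -/
def inord : LTree A → List A
  | leaf => []
  | node l a r => inord l ++ a :: inord r

/-- Underlying unlabeled binary tree. -/
def shape : LTree A → BTree
  | leaf => .leaf
  | node l _ r => .node (shape l) (shape r)

/-- Leaf insertion into a left binary search tree. -/
def insL [LinearOrder A] : LTree A → A → LTree A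
  | leaf, a => node leaf a leaf
  | node l b r, a => if a < b then node (insL l a) b r else node l b (insL r a)

/-- Leaf insertion into a right binary search tree. -/
def insR [LinearOrder A] : LTree A → A → LTree A
  | leaf, a => node leaf a leaf
  | node l b r, a => if a ≤ b then node (insR l a) b r else node l b (insR r a)

end LTree

/-- Left component of the Baxter P-symbol: leaf insert the letters of `u` from
left to right into a left binary search tree. -/
def PsymbL {A : Type*} [LinearOrder A] (u : List A) : LTree A :=
  u.foldl LTree.insL LTree.leaf

/-- Right component of the Baxter P-symbol: leaf insert the letters of `u` from
right to left into a right binary search tree. -/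
def PsymbR {A : Type*} [LinearOrder A] (u : List A) : LTree A :=
  u.reverse.foldl LTree.insR LTree.leaf

/-- Left binary search tree: each left label `a` and right label `c` of a node
labeled `b` satisfy `a < b ≤ c`. -/
def IsLeftBST {A : Type*} [LinearOrder A] : LTree A → Prop
  | .leaf => True
  | .node l b r =>
      (∀ a ∈ l.inord, a < b) ∧ (∀ c ∈ r.inord, b ≤ c) ∧ IsLeftBST l ∧ IsLeftBST r

/-- Right binary search tree: each left label `a` and right label `c` of a node
labeled `b` satisfy `a ≤ b < c`. -/
def IsRightBST {A : Type*} [LinearOrder A] : LTree A → Prop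
  | .leaf => True
  | .node l b r =>
      (∀ a ∈ l.inord, a ≤ b) ∧ (∀ c ∈ r.inord, b < c) ∧ IsRightBST l ∧ IsRightBST r

/-- Labels in inorder, interleaved with leaf orientations: the row starts and ends with an
orientation bit. -/
inductive OrientedRow (A : Type*) : Type _
  | last : Bool → OrientedRow A
  | cons : Bool → A → OrientedRow A → OrientedRow A

namespace OrientedRow

variable {A : Type*}

def labels : OrientedRow A → List A
  | last _ => []
  | cons _ a r => a :: labels r

def bits : OrientedRow A → List Bool
  | last o => [o]
  | cons o _ r => o :: bits r

/-- Join two rows around a label. -/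
def join : OrientedRow A → A → OrientedRow A → OrientedRow A
  | last o, b, r => cons o b r
  | cons o a s, b, r => cons o a (join s b r)

/-- Insert `a` in the gap before the first label `b` with `p a b`, replacing the bit of that gap by
`x` before `a` and `y` after `a`. -/
def insert (p : A → A → Prop) [DecidableRel p] (x y : Bool) (a : A) :
    OrientedRow A → OrientedRow A
  | last _ => cons x a (last y)
  | cons o b r => if p a b then cons x a (cons y b r) else cons o b (insert p x y a r)

/-- The labels agree and the bits correspond under `f`, the last bit being ignored. -/
def AgreeInit (f : Bool → Bool) : OrientedRow A → OrientedRow A → Prop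
  | last _, last _ => True
  | cons o a r, cons o' a' r' => o' = f o ∧ a = a' ∧ AgreeInit f r r'
  | _, _ => False

/-- The labels agree and the bits correspond under `f`, the first and last bits being ignored. -/
def AgreeInterior (f : Bool → Bool) : OrientedRow A → OrientedRow A → Prop
  | last _, last _ => True
  | cons _ a r, cons _ a' r' => a = a' ∧ AgreeInit f r r'
  | _, _ => False

theorem AgreeInit.insert (p : A → A → Prop) [DecidableRel p] (f : Bool → Bool) (x y : Bool)
    (a : A) : ∀ {r r' : OrientedRow A}, AgreeInit f r r' →
      AgreeInit f (r.insert p x y a) (r'.insert p (f x) (f y) a)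
  | last _, last _, _ => by simp [OrientedRow.insert, AgreeInit]
  | cons o b r, cons o' b' r', ⟨ho, hb, h⟩ => by
    subst ho hb
    have ih := AgreeInit.insert p f x y a h
    by_cases hp : p a b <;> simp_all [OrientedRow.insert, AgreeInit]

theorem AgreeInterior.insert (p : A → A → Prop) [DecidableRel p] (f : Bool → Bool) (x y : Bool)
    (a : A) : ∀ {r r' : OrientedRow A}, AgreeInterior f r r' →
      AgreeInterior f (r.insert p x y a) (r'.insert p (f x) (f y) a)
  | last _, last _, _ => by simp [OrientedRow.insert, AgreeInit, AgreeInterior]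
  | cons o b r, cons o' b' r', ⟨hb, h⟩ => by
    subst hb
    have ih := AgreeInit.insert p f x y a h
    by_cases hp : p a b <;> simp_all [OrientedRow.insert, AgreeInit, AgreeInterior]

theorem AgreeInit.trans {f g : Bool → Bool} : ∀ {r s t : OrientedRow A},
    AgreeInit f r s → AgreeInit g s t → AgreeInit (g ∘ f) r t
  | last _, last _, last _, _, _ => trivial
  | cons _ _ _, cons _ _ _, cons _ _ _, ⟨h₁, h₂, h₃⟩, ⟨k₁, k₂, k₃⟩ =>
    ⟨by simp [k₁, h₁], h₂.trans k₂, h₃.trans k₃⟩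

theorem AgreeInterior.trans {f g : Bool → Bool} : ∀ {r s t : OrientedRow A},
    AgreeInterior f r s → AgreeInterior g s t → AgreeInterior (g ∘ f) r t
  | last _, last _, last _, _, _ => trivial
  | cons _ _ _, cons _ _ _, cons _ _ _, ⟨h₂, h₃⟩, ⟨k₂, k₃⟩ => ⟨h₂.trans k₂, h₃.trans k₃⟩

theorem bits_ne_nil (r : OrientedRow A) : r.bits ≠ [] := by
  cases r <;> simp [bits]

theorem AgreeInit.dropLast_bits {f : Bool → Bool} : ∀ {r r' : OrientedRow A},
    AgreeInit f r r' → r'.bits.dropLast = r.bits.dropLast.map f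
  | last _, last _, _ => rfl
  | cons _ _ r, cons _ _ r', ⟨ho, _, h⟩ => by
    simp [bits, List.dropLast_cons_of_ne_nil (bits_ne_nil _), ho, h.dropLast_bits]

theorem AgreeInterior.interior_bits {f : Bool → Bool} : ∀ {r r' : OrientedRow A},
    AgreeInterior f r r' → (r'.bits.drop 1).dropLast = (r.bits.drop 1).dropLast.map f
  | last _, last _, _ => rfl
  | cons _ _ _, cons _ _ _, ⟨_, h⟩ => h.dropLast_bits

theorem insert_join_of_pos (p : A → A → Prop) [DecidableRel p] (x y : Bool) {a b : A}
    (h : p a b) (r : OrientedRow A) : ∀ s : OrientedRow A,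
      (s.join b r).insert p x y a = (s.insert p x y a).join b r
  | last _ => by simp [join, insert, h]
  | cons o c s => by
    have ih := insert_join_of_pos p x y h r s
    by_cases hc : p a c <;> simp [join, insert, hc, ih]

theorem insert_join_of_neg (p : A → A → Prop) [DecidableRel p] (x y : Bool) {a b : A}
    (h : ¬ p a b) (r : OrientedRow A) : ∀ s : OrientedRow A, (∀ c ∈ s.labels, ¬ p a c) →
      (s.join b r).insert p x y a = s.join b (r.insert p x y a)
  | last _, _ => by simp [join, insert, h]
  | cons o c s, hs => by
    simp only [labels, List.mem_cons, forall_eq_or_imp] at hs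
    simp [join, insert, hs.1, insert_join_of_neg p x y h r s hs.2]

theorem labels_join (b : A) (r : OrientedRow A) : ∀ s : OrientedRow A,
    (s.join b r).labels = s.labels ++ b :: r.labels
  | last _ => rfl
  | cons _ _ s => by simp [join, labels, labels_join b r s]

theorem bits_join (b : A) (r : OrientedRow A) : ∀ s : OrientedRow A,
    (s.join b r).bits = s.bits ++ r.bits
  | last _ => rfl
  | cons _ _ s => by simp [join, bits, bits_join b r s]

theorem insert_lt_insert_le_comm [LinearOrder A] (x y : Bool) (a b : A) :
    ∀ r : OrientedRow A,
      (r.insert (· ≤ ·) y x a).insert (· < ·) x y b =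
        (r.insert (· < ·) x y b).insert (· ≤ ·) y x a
  | last _ => by
    by_cases h : a ≤ b
    · simp [insert, h, not_lt.2 h]
    · simp [insert, h, not_le.1 h]
  | cons o c r => by
    have ih := insert_lt_insert_le_comm x y a b r
    by_cases h : a ≤ b <;> by_cases hb : b < c <;> by_cases ha : a ≤ c <;>
      simp [insert, h, ha, hb, ih] <;> grind

theorem foldl_insert_lt_insert_le [LinearOrder A] (x y : Bool) (a : A) (u : List A) :
    ∀ r : OrientedRow A,
      u.foldl (fun s b => s.insert (· < ·) x y b) (r.insert (· ≤ ·) y x a) =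
        (u.foldl (fun s b => s.insert (· < ·) x y b) r).insert (· ≤ ·) y x a := by
  induction u with
  | nil => simp
  | cons b u ih => intro r; simp only [List.foldl_cons, insert_lt_insert_le_comm, ih]

theorem AgreeInterior.foldl_insert (p : A → A → Prop) [DecidableRel p] (f : Bool → Bool)
    (x y : Bool) (u : List A) : ∀ {r r' : OrientedRow A}, AgreeInterior f r r' →
      AgreeInterior f (u.foldl (fun s b => s.insert p x y b) r)
        (u.foldl (fun s b => s.insert p (f x) (f y) b) r') := by
  induction u with
  | nil => exact fun h => h
  | cons b u ih => exact fun h => ih (h.insert p f x y b)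

theorem agreeInterior_foldl_foldr [LinearOrder A] (u : List A) (o : Bool) :
    AgreeInterior not (u.foldl (fun s b => s.insert (· < ·) true false b) (last o))
      (u.foldr (fun b s => s.insert (· ≤ ·) true false b) (last o)) := by
  induction u with
  | nil => trivial
  | cons a u ih =>
    have h₀ : AgreeInterior id ((last o).insert (· < ·) true false a)
        ((last o).insert (· ≤ ·) false true a) := ⟨rfl, trivial⟩
    have h₁ := h₀.foldl_insert (· < ·) id true false u
    simp only [id, foldl_insert_lt_insert_le] at h₁
    exact h₁.trans (ih.insert (· ≤ ·) not false true a)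

end OrientedRow

namespace LTree

variable {A : Type*}

/-- The oriented row of a tree, `o` being the orientation of the root. -/
def row : Bool → LTree A → OrientedRow A
  | o, leaf => .last o
  | _, node l b r => (row true l).join b (row false r)

theorem labels_row (o : Bool) (t : LTree A) : (t.row o).labels = t.inord := by
  induction t generalizing o with
  | leaf => rfl
  | node l b r ihl ihr => simp [row, OrientedRow.labels_join, inord, ihl, ihr]

theorem bits_row (o : Bool) (t : LTree A) :
    (t.row o).bits = if t.shape.isLeaf then [o] else t.shape.orients := by
  induction t generalizing o with
  | leaf => rfl
  | node l b r ihl ihr =>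
    simp [row, OrientedRow.bits_join, shape, BTree.isLeaf, BTree.orients, ihl, ihr]

theorem canopy_shape (o : Bool) (t : LTree A) :
    t.shape.canopy = ((t.row o).bits.drop 1).dropLast := by
  rw [bits_row]
  cases t <;> rfl

theorem size_shape (t : LTree A) : t.shape.size = t.inord.length := by
  induction t with
  | leaf => rfl
  | node l b r ihl ihr => simp [shape, BTree.size, inord, ihl, ihr, add_assoc]

variable [LinearOrder A]

theorem inord_insL_perm (t : LTree A) (a : A) : (t.insL a).inord.Perm (a :: t.inord) := by
  induction t with
  | leaf => rfl
  | node l b r ihl ihr =>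
    rw [insL]
    split_ifs
    · exact ihl.append_right _
    · exact (((ihr.cons b).trans (.swap _ _ _)).append_left _).trans List.perm_middle

theorem inord_insR_perm (t : LTree A) (a : A) : (t.insR a).inord.Perm (a :: t.inord) := by
  induction t with
  | leaf => rfl
  | node l b r ihl ihr =>
    rw [insR]
    split_ifs
    · exact ihl.append_right _
    · exact (((ihr.cons b).trans (.swap _ _ _)).append_left _).trans List.perm_middle

theorem isLeftBST_insL (a : A) {t : LTree A} (h : IsLeftBST t) : IsLeftBST (t.insL a) := by
  induction t with
  | leaf => simp [insL, IsLeftBST, inord]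
  | node l b r ihl ihr =>
    obtain ⟨hl, hr, hl', hr'⟩ := h
    rw [insL]
    split_ifs with hab
    · refine ⟨fun c hc => ?_, hr, ihl hl', hr'⟩
      rcases List.mem_cons.1 ((inord_insL_perm l a).subset hc) with rfl | hc
      exacts [hab, hl c hc]
    · refine ⟨hl, fun c hc => ?_, hl', ihr hr'⟩
      rcases List.mem_cons.1 ((inord_insL_perm r a).subset hc) with rfl | hc
      exacts [not_lt.1 hab, hr c hc]

theorem isRightBST_insR (a : A) {t : LTree A} (h : IsRightBST t) : IsRightBST (t.insR a) := by
  induction t with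
  | leaf => simp [insR, IsRightBST, inord]
  | node l b r ihl ihr =>
    obtain ⟨hl, hr, hl', hr'⟩ := h
    rw [insR]
    split_ifs with hab
    · refine ⟨fun c hc => ?_, hr, ihl hl', hr'⟩
      rcases List.mem_cons.1 ((inord_insR_perm l a).subset hc) with rfl | hc
      exacts [hab, hl c hc]
    · refine ⟨hl, fun c hc => ?_, hl', ihr hr'⟩
      rcases List.mem_cons.1 ((inord_insR_perm r a).subset hc) with rfl | hc
      exacts [not_le.1 hab, hr c hc]

theorem pairwise_inord_of_isLeftBST {t : LTree A} (h : IsLeftBST t) :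
    t.inord.Pairwise (· ≤ ·) := by
  induction t with
  | leaf => exact .nil
  | node l b r ihl ihr =>
    obtain ⟨hl, hr, hl', hr'⟩ := h
    refine List.pairwise_append.2 ⟨ihl hl', List.pairwise_cons.2 ⟨hr, ihr hr'⟩, ?_⟩
    intro x hx y hy
    rcases List.mem_cons.1 hy with rfl | hy
    exacts [(hl x hx).le, (hl x hx).le.trans (hr y hy)]

theorem pairwise_inord_of_isRightBST {t : LTree A} (h : IsRightBST t) :
    t.inord.Pairwise (· ≤ ·) := by
  induction t with
  | leaf => exact .nil
  | node l b r ihl ihr =>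
    obtain ⟨hl, hr, hl', hr'⟩ := h
    refine List.pairwise_append.2
      ⟨ihl hl', List.pairwise_cons.2 ⟨fun c hc => (hr c hc).le, ihr hr'⟩, ?_⟩
    intro x hx y hy
    rcases List.mem_cons.1 hy with rfl | hy
    exacts [hl x hx, (hl x hx).trans (hr y hy).le]

theorem row_insL (a : A) {t : LTree A} (h : IsLeftBST t) (o : Bool) :
    (t.insL a).row o = (t.row o).insert (· < ·) true false a := by
  induction t generalizing o with
  | leaf => rfl
  | node l b r ihl ihr =>
    obtain ⟨hl, hr, hl', hr'⟩ := h
    rw [insL]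
    split_ifs with hab
    · simp only [row, ihl hl', OrientedRow.insert_join_of_pos (· < ·) true false hab]
    · simp only [row, ihr hr']
      refine (OrientedRow.insert_join_of_neg (· < ·) true false hab _ _ fun c hc => ?_).symm
      rw [labels_row] at hc
      exact not_lt.2 ((hl c hc).le.trans (not_lt.1 hab))

theorem row_insR (a : A) {t : LTree A} (h : IsRightBST t) (o : Bool) :
    (t.insR a).row o = (t.row o).insert (· ≤ ·) true false a := by
  induction t generalizing o with
  | leaf => rfl
  | node l b r ihl ihr =>
    obtain ⟨hl, hr, hl', hr'⟩ := h
    rw [insR]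
    split_ifs with hab
    · simp only [row, ihl hl', OrientedRow.insert_join_of_pos (· ≤ ·) true false hab]
    · simp only [row, ihr hr']
      refine (OrientedRow.insert_join_of_neg (· ≤ ·) true false hab _ _ fun c hc => ?_).symm
      rw [labels_row] at hc
      exact not_le.2 ((hl c hc).trans_lt (not_le.1 hab))

end LTree

section Psymb

variable {A : Type*} [LinearOrder A]

theorem psymbL_append_singleton (u : List A) (a : A) :
    PsymbL (u ++ [a]) = (PsymbL u).insL a := by
  simp [PsymbL]

theorem psymbR_cons (a : A) (u : List A) : PsymbR (a :: u) = (PsymbR u).insR a := by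
  simp [PsymbR]

theorem isLeftBST_psymbL (u : List A) : IsLeftBST (PsymbL u) := by
  induction u using List.reverseRecOn with
  | nil => trivial
  | append_singleton u a ih => simpa [psymbL_append_singleton] using LTree.isLeftBST_insL a ih

theorem isRightBST_psymbR (u : List A) : IsRightBST (PsymbR u) := by
  induction u with
  | nil => trivial
  | cons a u ih => simpa [psymbR_cons] using LTree.isRightBST_insR a ih

theorem inord_psymbL_perm (u : List A) : (PsymbL u).inord.Perm u := by
  induction u using List.reverseRecOn with
  | nil => rfl
  | append_singleton u a ih =>
    rw [psymbL_append_singleton]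
    exact (LTree.inord_insL_perm _ a).trans ((ih.cons a).trans (List.perm_append_singleton a u).symm)

theorem inord_psymbR_perm (u : List A) : (PsymbR u).inord.Perm u := by
  induction u with
  | nil => rfl
  | cons a u ih =>
    rw [psymbR_cons]
    exact (LTree.inord_insR_perm _ a).trans (ih.cons a)

theorem row_psymbL (u : List A) (o : Bool) :
    (PsymbL u).row o = u.foldl (fun s b => s.insert (· < ·) true false b) (.last o) := by
  induction u using List.reverseRecOn with
  | nil => rfl
  | append_singleton u a ih =>
    simp [psymbL_append_singleton, LTree.row_insL a (isLeftBST_psymbL u), ih]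

theorem row_psymbR (u : List A) (o : Bool) :
    (PsymbR u).row o = u.foldr (fun b s => s.insert (· ≤ ·) true false b) (.last o) := by
  induction u with
  | nil => rfl
  | cons a u ih => simp [psymbR_cons, LTree.row_insR a (isRightBST_psymbR u), ih]

theorem canopy_psymbR (u : List A) :
    (PsymbR u).shape.canopy = (PsymbL u).shape.canopy.map not := by
  rw [LTree.canopy_shape true, LTree.canopy_shape true, row_psymbL, row_psymbR]
  exact (OrientedRow.agreeInterior_foldl_foldr u true).interior_bits

theorem eq_insertionSort_of_perm {l u : List A} (h : l.Perm u) (hl : l.Pairwise (· ≤ ·)) :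
    l = u.insertionSort (· ≤ ·) :=
  (h.trans (List.perm_insertionSort _ u).symm).eq_of_pairwise
    (fun _ _ _ _ => le_antisymm) hl (List.pairwise_insertionSort _ u)

end Psymb

/-- For any word `u`, writing `P(u) = (T_L, T_R)` for its Baxter
P-symbol: `T_L` is a left binary search tree, `T_R` is a right binary search tree,
the inorder readings of both equal the nondecreasing rearrangement of `u`, and
their shapes form a pair of twin binary trees. -/
theorem psymb_is_twin_bst {A : Type*} [LinearOrder A] (u : List A) :
    IsLeftBST (PsymbL u) ∧ IsRightBST (PsymbR u) ∧
    (PsymbL u).inord = u.insertionSort (· ≤ ·) ∧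
    (PsymbR u).inord = u.insertionSort (· ≤ ·) ∧
    TwinPair (PsymbL u).shape (PsymbR u).shape := by
  refine ⟨isLeftBST_psymbL u, isRightBST_psymbR u,
    eq_insertionSort_of_perm (inord_psymbL_perm u)
      (LTree.pairwise_inord_of_isLeftBST (isLeftBST_psymbL u)),
    eq_insertionSort_of_perm (inord_psymbR_perm u)
      (LTree.pairwise_inord_of_isRightBST (isRightBST_psymbR u)), ?_, ?_⟩
  · rw [LTree.size_shape, LTree.size_shape, (inord_psymbL_perm u).length_eq,
      (inord_psymbR_perm u).length_eq]
  · intro i b b' hb hb'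
    rw [canopy_psymbR, List.getElem?_map, hb] at hb'
    obtain rfl : (!b) = b' := Option.some.inj hb'
    simp
end

section
/- For all words u, v ∈ A*, one has u ≡_B v if and only if P(u) = P(v), where P denotes the Baxter P-symbol. -/
section LeftTree

variable {A : Type*} [LinearOrder A]

theorem foldl_insL_node (l r : LTree A) (x : A) (u : List A) :
    u.foldl LTree.insL (LTree.node l x r) =
      LTree.node ((u.filter (· < x)).foldl LTree.insL l) x
        ((u.filter (x ≤ ·)).foldl LTree.insL r) := by
  induction u generalizing l r with
  | nil => rfl
  | cons y u ih =>
    by_cases h : y < x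
    · simp [LTree.insL, h, ih]
    · simp [LTree.insL, h, ih, not_lt.mp h]

theorem psymbL_cons (x : A) (u : List A) :
    PsymbL (x :: u) =
      LTree.node (PsymbL (u.filter (· < x))) x (PsymbL (u.filter (x ≤ ·))) :=
  foldl_insL_node _ _ _ _

theorem psymbL_cons_inj {x y : A} {u v : List A} :
    PsymbL (x :: u) = PsymbL (y :: v) ↔
      x = y ∧ PsymbL (u.filter (· < x)) = PsymbL (v.filter (· < x)) ∧
        PsymbL (u.filter (x ≤ ·)) = PsymbL (v.filter (x ≤ ·)) := by
  rw [psymbL_cons, psymbL_cons, LTree.node.injEq]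
  constructor
  · rintro ⟨h1, rfl, h2⟩; exact ⟨rfl, h1, h2⟩
  · rintro ⟨rfl, h1, h2⟩; exact ⟨h1, rfl, h2⟩

theorem exists_eq_cons_of_psymbL_eq {x : A} {s t : List A}
    (h : PsymbL (x :: s) = PsymbL t) : ∃ t', t = x :: t' := by
  cases t with
  | nil => rw [psymbL_cons] at h; exact nomatch h
  | cons y t => exact ⟨t, by rw [(psymbL_cons_inj.mp h).1]⟩

theorem eq_nil_of_psymbL_eq {t : List A} (h : PsymbL [] = PsymbL t) : t = [] := by
  cases t with
  | nil => rfl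
  | cons y t => rw [psymbL_cons] at h; exact nomatch h

theorem filter_lt_append_filter_ge_perm (x : A) (u : List A) :
    (u.filter (· < x) ++ u.filter (x ≤ ·)).Perm u := by
  have h := List.filter_append_perm (fun y => decide (y < x)) u
  have e : (fun y => !decide (y < x)) = fun y => decide (x ≤ y) := by
    funext y; simp [← not_lt]
  rwa [e] at h

theorem perm_of_psymbL_eq (u v : List A) (h : PsymbL u = PsymbL v) : u.Perm v := by
  match u with
  | [] => rw [eq_nil_of_psymbL_eq h]
  | x :: u =>
    obtain ⟨v, rfl⟩ := exists_eq_cons_of_psymbL_eq h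
    obtain ⟨-, h1, h2⟩ := psymbL_cons_inj.mp h
    have p1 := perm_of_psymbL_eq _ _ h1
    have p2 := perm_of_psymbL_eq _ _ h2
    exact (((filter_lt_append_filter_ge_perm x u).symm.trans (p1.append p2)).trans
      (filter_lt_append_filter_ge_perm x v)).cons x
termination_by u.length
decreasing_by
  all_goals
    simp only [List.length_cons]
    exact Nat.lt_succ_of_le (List.length_filter_le _ _)

/-- Restricting words to an interval of letters preserves equality of left trees. -/
theorem psymbL_filter_Icc (a d : A) (u v : List A) (h : PsymbL u = PsymbL v) :
    PsymbL (u.filter fun z => a ≤ z ∧ z ≤ d) = PsymbL (v.filter fun z => a ≤ z ∧ z ≤ d) := by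
  match u with
  | [] => rw [eq_nil_of_psymbL_eq h]
  | x :: u =>
    obtain ⟨v, rfl⟩ := exists_eq_cons_of_psymbL_eq h
    obtain ⟨-, h1, h2⟩ := psymbL_cons_inj.mp h
    have p1 := psymbL_filter_Icc a d _ _ h1
    have p2 := psymbL_filter_Icc a d _ _ h2
    rw [List.filter_filter, List.filter_filter] at p1 p2
    by_cases hx : a ≤ x ∧ x ≤ d
    · rw [List.filter_cons_of_pos (by simpa using hx), List.filter_cons_of_pos (by simpa using hx),
        psymbL_cons_inj]
      simp only [List.filter_filter]
      refine ⟨trivial, ?_, ?_⟩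
      · simpa only [Bool.and_comm] using p1
      · simpa only [Bool.and_comm] using p2
    · rw [List.filter_cons_of_neg (by simpa using hx), List.filter_cons_of_neg (by simpa using hx)]
      rcases lt_or_ge x a with hxa | hxa
      · have e : (fun z => decide (a ≤ z ∧ z ≤ d) && decide (x ≤ z)) =
            fun z => decide (a ≤ z ∧ z ≤ d) := by
          funext z
          rw [Bool.eq_iff_iff]
          simp only [Bool.and_eq_true, decide_eq_true_eq]
          grind
        rwa [e] at p2
      · have e : (fun z => decide (a ≤ z ∧ z ≤ d) && decide (z < x)) =
            fun z => decide (a ≤ z ∧ z ≤ d) := by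
          funext z
          rw [Bool.eq_iff_iff]
          simp only [Bool.and_eq_true, decide_eq_true_eq]
          grind
        rwa [e] at p1
termination_by u.length
decreasing_by
  all_goals
    simp only [List.length_cons]
    exact Nat.lt_succ_of_le (List.length_filter_le _ _)

theorem exists_eq_replicate_append_of_psymbL_eq {a : A} (j : ℕ) {s u : List A}
    (hs : ∀ z ∈ s, a ≤ z) (hu : ∀ z ∈ u, a ≤ z)
    (h : PsymbL (List.replicate j a ++ s) = PsymbL u) :
    ∃ t, u = List.replicate j a ++ t ∧ PsymbL s = PsymbL t := by
  induction j generalizing u with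
  | zero => exact ⟨u, by simp, by simpa using h⟩
  | succ j ih =>
    rw [List.replicate_succ, List.cons_append] at h
    obtain ⟨u, rfl⟩ := exists_eq_cons_of_psymbL_eq h
    have hu' : ∀ z ∈ u, a ≤ z := fun z hz => hu z (List.mem_cons_of_mem _ hz)
    have hs' : ∀ z ∈ List.replicate j a ++ s, a ≤ z := by
      intro z hz
      rcases List.mem_append.mp hz with hz | hz
      · rw [List.eq_of_mem_replicate hz]
      · exact hs z hz
    have h2 := (psymbL_cons_inj.mp h).2.2
    rw [List.filter_eq_self.mpr fun z hz => decide_eq_true (hs' z hz),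
      List.filter_eq_self.mpr fun z hz => decide_eq_true (hu' z hz)] at h2
    obtain ⟨t, rfl, ht⟩ := ih hu' h2
    exact ⟨t, by simp [List.replicate_succ], ht⟩

theorem psymbL_swap {a d : A} (had : a < d) (p s : List A) (hp : ∃ z ∈ p, a < z ∧ z ≤ d) :
    PsymbL (p ++ a :: d :: s) = PsymbL (p ++ d :: a :: s) := by
  match p with
  | [] => simp at hp
  | x :: p =>
    obtain ⟨z, hz, haz, hzd⟩ := hp
    rw [List.cons_append, List.cons_append, psymbL_cons_inj]
    simp only [List.filter_append]
    refine ⟨trivial, ?_, ?_⟩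
    · by_cases hd : d < x
      · have ha := had.trans hd
        have hzp : z ∈ p := (List.mem_cons.mp hz).resolve_left (hzd.trans_lt hd).ne
        simpa [List.filter_cons, hd, ha] using psymbL_swap had (p.filter (· < x))
          (s.filter (· < x)) ⟨z, by simp [hzp, hzd.trans_lt hd], haz, hzd⟩
      · simp [List.filter_cons, hd]
    · by_cases ha : x ≤ a
      · have hd := ha.trans had.le
        have hzp : z ∈ p := (List.mem_cons.mp hz).resolve_left (ha.trans_lt haz).ne'
        simpa [List.filter_cons, hd, ha] using psymbL_swap had (p.filter (x ≤ ·))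
          (s.filter (x ≤ ·)) ⟨z, by simp [hzp, (ha.trans_lt haz).le], haz, hzd⟩
      · simp [List.filter_cons, ha]
termination_by p.length
decreasing_by
  all_goals
    simp only [List.length_cons]
    exact Nat.lt_succ_of_le (List.length_filter_le _ _)

theorem filter_Icc_eq_replicate {a d : A} {p : List A} (h : ¬ ∃ z ∈ p, a < z ∧ z ≤ d) :
    ∃ k, p.filter (fun z => a ≤ z ∧ z ≤ d) = List.replicate k a := by
  refine ⟨_, List.eq_replicate_iff.mpr ⟨rfl, fun z hz => ?_⟩⟩
  simp only [List.mem_filter, decide_eq_true_eq] at hz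
  by_contra hne
  exact h ⟨z, hz.1, lt_of_le_of_ne hz.2.1 (Ne.symm hne), hz.2.2⟩

theorem exists_separator_of_common_prefix {a d x y : A} {p s w t : List A}
    (hx : a ≤ x ∧ x ≤ d) (hy : a ≤ y ∧ y ≤ d) (hxw : x ∉ w) (hyw : y ∈ w)
    (h : PsymbL (p ++ x :: s) = PsymbL (p ++ (w ++ x :: t))) :
    ∃ z ∈ p, a < z ∧ z ≤ d := by
  by_contra hp
  obtain ⟨k, hk⟩ := filter_Icc_eq_replicate hp
  have h' := psymbL_filter_Icc a d _ _ h
  rw [List.filter_append, List.filter_append, hk] at h'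
  have hmem : ∀ l : List A, ∀ z ∈ l.filter (fun z => a ≤ z ∧ z ≤ d), a ≤ z := by
    intro l z hz
    simp only [List.mem_filter, decide_eq_true_eq] at hz
    exact hz.2.1
  obtain ⟨t', ht', h''⟩ := exists_eq_replicate_append_of_psymbL_eq k (hmem _)
    (by
      intro z hz
      rcases List.mem_append.mp hz with hz | hz
      · rw [List.eq_of_mem_replicate hz]
      · exact hmem _ z hz) h'
  rw [← List.append_cancel_left ht', List.filter_cons_of_pos (by simpa using hx),
    List.filter_append] at h''
  obtain ⟨t'', e⟩ := exists_eq_cons_of_psymbL_eq h''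
  have hyf : y ∈ w.filter (fun z => a ≤ z ∧ z ≤ d) := by simp [hyw, hy]
  cases hw : w.filter (fun z => a ≤ z ∧ z ≤ d) with
  | nil => rw [hw] at hyf; exact absurd hyf List.not_mem_nil
  | cons b w' =>
    rw [hw, List.cons_append, List.cons.injEq] at e
    have hb : b ∈ w.filter (fun z => a ≤ z ∧ z ≤ d) := by
      rw [hw]; exact List.mem_cons_self
    rw [e.1] at hb
    exact hxw (List.mem_of_mem_filter hb)

theorem exists_separator_of_common_suffix {a d x y : A} {p q r w : List A}
    (hx : a ≤ x ∧ x ≤ d) (hy : a ≤ y ∧ y ≤ d) (hxw : x ∉ w) (hyw : y ∈ w)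
    (h : PsymbL (r ++ x :: (w ++ p)) = PsymbL (q ++ x :: p)) :
    ∃ z ∈ r, a < z ∧ z ≤ d := by
  by_contra hr
  obtain ⟨k, hk⟩ := filter_Icc_eq_replicate hr
  have h' := psymbL_filter_Icc a d _ _ h
  have hperm := perm_of_psymbL_eq _ _ h'
  rw [List.filter_append, hk] at h'
  have hmem : ∀ l : List A, ∀ z ∈ l.filter (fun z => a ≤ z ∧ z ≤ d), a ≤ z := by
    intro l z hz
    simp only [List.mem_filter, decide_eq_true_eq] at hz
    exact hz.2.1
  obtain ⟨t, ht, h''⟩ := exists_eq_replicate_append_of_psymbL_eq k (hmem _) (hmem _) h'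
  rw [List.filter_cons_of_pos (by simpa using hx)] at h''
  obtain ⟨t', rfl⟩ := exists_eq_cons_of_psymbL_eq h''
  have hyf : y ∈ w.filter (fun z => a ≤ z ∧ z ≤ d) := by simp [hyw, hy]
  have hxf : x ∉ w.filter (fun z => a ≤ z ∧ z ≤ d) := fun hm => hxw (List.mem_of_mem_filter hm)
  have hcount := hperm.count_eq x
  have hlen := hperm.length_eq
  have hcons (l : List A) : (x :: l).filter (fun z => a ≤ z ∧ z ≤ d) =
      x :: l.filter fun z => a ≤ z ∧ z ≤ d := List.filter_cons_of_pos (decide_eq_true hx)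
  simp only [List.filter_append, hk, hcons] at ht hcount hlen
  have hpos := List.length_pos_of_mem hyf
  have hcw := List.count_eq_zero.mpr hxf
  generalize q.filter (fun z => a ≤ z ∧ z ≤ d) = q' at *
  have hpre : (List.replicate k a ++ [x]) <+: q' := by
    apply List.prefix_of_prefix_length_le (l₃ := q' ++ x :: p.filter fun z => a ≤ z ∧ z ≤ d)
    · exact ⟨t', by rw [ht]; simp⟩
    · exact List.prefix_append _ _
    · simp only [List.length_append, List.length_cons, List.length_replicate] at hlen ⊢
      simp only [List.length_nil]
      omega
  have hle := hpre.sublist.count_le x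
  simp only [List.count_append, List.count_cons_self, List.count_nil] at hcount hle
  omega

end LeftTree

section Mirror

variable {A : Type*}

/-- The mirror image of a tree, labeled by the dual order. -/
def LTree.mirror : LTree A → LTree Aᵒᵈ
  | leaf => leaf
  | node l b r => node r.mirror (OrderDual.toDual b) l.mirror

theorem LTree.mirror_injective : Function.Injective (LTree.mirror (A := A)) := by
  intro s
  induction s with
  | leaf => intro t h; cases t with
    | leaf => rfl
    | node l b r => exact nomatch h
  | node l b r ihl ihr => intro t h; cases t with
    | leaf => exact nomatch h
    | node l' b' r' =>
      simp only [mirror, node.injEq] at h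
      rw [ihl h.2.2, ihr h.1, OrderDual.toDual.injective h.2.1]

variable [LinearOrder A]

theorem LTree.mirror_insR (t : LTree A) (a : A) :
    (t.insR a).mirror = t.mirror.insL (OrderDual.toDual a) := by
  induction t with
  | leaf => rfl
  | node l b r ihl ihr =>
    by_cases h : a ≤ b
    · simp [insR, insL, mirror, h, ihl, not_lt.mpr h]
    · simp [insR, insL, mirror, h, ihr, not_le.mp h]

theorem mirror_foldl_insR (t : LTree A) (u : List A) :
    (u.foldl LTree.insR t).mirror = (u.map OrderDual.toDual).foldl LTree.insL t.mirror := by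
  induction u generalizing t with
  | nil => rfl
  | cons a u ih => simp [ih, LTree.mirror_insR]

/-- Equality of right trees is equality of left trees of the reversed words over the dual order. -/
theorem psymbR_eq_iff {u v : List A} :
    PsymbR u = PsymbR v ↔ PsymbL (u.reverse.map OrderDual.toDual) =
      PsymbL (v.reverse.map OrderDual.toDual) := by
  rw [← LTree.mirror_injective.eq_iff]
  simp only [PsymbR, mirror_foldl_insR]
  rfl

theorem psymbR_swap {a d : A} (had : a < d) (p s : List A) (hs : ∃ z ∈ s, a ≤ z ∧ z < d) :
    PsymbR (p ++ a :: d :: s) = PsymbR (p ++ d :: a :: s) := by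
  rw [psymbR_eq_iff]
  obtain ⟨z, hz, haz, hzd⟩ := hs
  have h := psymbL_swap (a := OrderDual.toDual d) (d := OrderDual.toDual a) had (s.reverse.map OrderDual.toDual)
    (p.reverse.map OrderDual.toDual) ⟨OrderDual.toDual z,
      List.mem_map_of_mem (List.mem_reverse.mpr hz), hzd, haz⟩
  simpa using h

theorem exists_separator_of_psymbR_eq {a d x y : A} {p s w t : List A}
    (hx : a ≤ x ∧ x ≤ d) (hy : a ≤ y ∧ y ≤ d) (hxw : x ∉ w) (hyw : y ∈ w)
    (h : PsymbR (p ++ x :: s) = PsymbR (p ++ (w ++ x :: t))) :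
    ∃ z ∈ t, a ≤ z ∧ z < d := by
  rw [psymbR_eq_iff] at h
  obtain ⟨z, hz, hdz, hza⟩ := exists_separator_of_common_suffix
    (a := OrderDual.toDual d) (d := OrderDual.toDual a)
    (x := OrderDual.toDual x) (y := OrderDual.toDual y)
    (p := p.reverse.map OrderDual.toDual) (q := s.reverse.map OrderDual.toDual)
    (r := t.reverse.map OrderDual.toDual) (w := w.reverse.map OrderDual.toDual)
    ⟨hx.2, hx.1⟩ ⟨hy.2, hy.1⟩ (by simpa using hxw) (by simpa using hyw)
    (by simpa using h.symm)
  simp only [List.mem_map, List.mem_reverse] at hz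
  obtain ⟨z, hz, rfl⟩ := hz
  exact ⟨z, hz, hza, hdz⟩

end Mirror

namespace BaxterEquiv

variable {A : Type*} [LinearOrder A]

theorem swap {a d : A} {p s : List A} (hp : ∃ z ∈ p, a < z ∧ z ≤ d)
    (hs : ∃ z ∈ s, a ≤ z ∧ z < d) : BaxterEquiv (p ++ a :: d :: s) (p ++ d :: a :: s) := by
  obtain ⟨z, hz, haz, hzd⟩ := hp
  obtain ⟨z', hz', haz', hzd'⟩ := hs
  obtain ⟨p₁, p₂, rfl⟩ := List.append_of_mem hz
  obtain ⟨s₁, s₂, rfl⟩ := List.append_of_mem hz'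
  rcases lt_or_ge z' z with h | h
  · simpa using rel1 p₁ p₂ s₁ s₂ a z' z d haz' h hzd
  · simpa using (rel2 p₁ p₂ s₁ s₂ a z z' d haz h hzd').symm

theorem swap_min_max {x y : A} (hxy : x ≠ y) {p s : List A}
    (hp : ∃ z ∈ p, min x y < z ∧ z ≤ max x y)
    (hs : ∃ z ∈ s, min x y ≤ z ∧ z < max x y) :
    BaxterEquiv (p ++ y :: x :: s) (p ++ x :: y :: s) := by
  rcases lt_or_gt_of_ne hxy with h | h
  · rw [min_eq_left h.le, max_eq_right h.le] at hp hs
    exact (swap hp hs).symm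
  · rw [min_eq_right h.le, max_eq_left h.le] at hp hs
    exact swap hp hs

theorem move_left_s11 {x : A} {w p t : List A}
    (hw : ∀ y ∈ w, x ≠ y ∧ (∃ z ∈ p, min x y < z ∧ z ≤ max x y) ∧
      ∃ z ∈ t, min x y ≤ z ∧ z < max x y) :
    BaxterEquiv (p ++ (w ++ x :: t)) (p ++ x :: (w ++ t)) := by
  induction w generalizing p with
  | nil => exact refl _
  | cons y w ih =>
    have h1 : BaxterEquiv (p ++ [y] ++ (w ++ x :: t)) (p ++ [y] ++ x :: (w ++ t)) := by
      refine ih fun b hb => ?_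
      obtain ⟨hne, ⟨z, hz, hz'⟩, ht⟩ := hw b (List.mem_cons_of_mem _ hb)
      exact ⟨hne, ⟨z, List.mem_append_left _ hz, hz'⟩, ht⟩
    obtain ⟨hne, hp, z, hz, hz'⟩ := hw y List.mem_cons_self
    have h2 := swap_min_max hne hp (s := w ++ t) ⟨z, List.mem_append_right _ hz, hz'⟩
    simp only [List.append_assoc, List.cons_append, List.nil_append] at h1 ⊢
    exact h1.trans h2

theorem psymb_eq {u v : List A} (h : BaxterEquiv u v) :
    PsymbL u = PsymbL v ∧ PsymbR u = PsymbR v := by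
  induction h with
  | refl => exact ⟨rfl, rfl⟩
  | symm _ ih => exact ⟨ih.1.symm, ih.2.symm⟩
  | trans _ _ ih₁ ih₂ => exact ⟨ih₁.1.trans ih₂.1, ih₁.2.trans ih₂.2⟩
  | rel1 x u v y a b c d hab hbc hcd =>
    have had := (hab.trans_lt hbc).trans_le hcd
    have hL := psymbL_swap had (x ++ c :: u) (v ++ b :: y)
      ⟨c, by simp, hab.trans_lt hbc, hcd⟩
    have hR := psymbR_swap had (x ++ c :: u) (v ++ b :: y)
      ⟨b, by simp, hab, hbc.trans_le hcd⟩
    exact ⟨by simpa using hL, by simpa using hR⟩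
  | rel2 x u v y a b c d hab hbc hcd =>
    have had := (hab.trans_le hbc).trans hcd
    have hL := psymbL_swap had (x ++ b :: u) (v ++ c :: y)
      ⟨b, by simp, hab, (hbc.trans_lt hcd).le⟩
    have hR := psymbR_swap had (x ++ b :: u) (v ++ c :: y)
      ⟨c, by simp, (hab.trans_le hbc).le, hcd⟩
    exact ⟨by simpa using hL.symm, by simpa using hR.symm⟩

theorem of_psymb_eq_append (p u v : List A) (hL : PsymbL (p ++ u) = PsymbL (p ++ v))
    (hR : PsymbR (p ++ u) = PsymbR (p ++ v)) : BaxterEquiv (p ++ u) (p ++ v) := by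
  induction u generalizing p v with
  | nil =>
    have hperm := (List.perm_append_left_iff p).mp (perm_of_psymbL_eq _ _ hL)
    rw [List.nil_perm.mp hperm]
    exact refl _
  | cons x u ih =>
    have hperm := (List.perm_append_left_iff p).mp (perm_of_psymbL_eq _ _ hL)
    obtain ⟨w, t, rfl, hxw⟩ := List.eq_append_cons_of_mem (hperm.mem_iff.mp List.mem_cons_self)
    have hmove : BaxterEquiv (p ++ (w ++ x :: t)) (p ++ x :: (w ++ t)) := by
      refine move_left_s11 fun y hy => ⟨fun e => hxw (e ▸ hy), ?_, ?_⟩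
      · exact exists_separator_of_common_prefix ⟨min_le_left _ _, le_max_left _ _⟩
          ⟨min_le_right _ _, le_max_right _ _⟩ hxw hy hL
      · exact exists_separator_of_psymbR_eq ⟨min_le_left _ _, le_max_left _ _⟩
          ⟨min_le_right _ _, le_max_right _ _⟩ hxw hy hR
    obtain ⟨hL', hR'⟩ := hmove.psymb_eq
    have h := ih (p ++ [x]) (w ++ t) (by simpa using hL.trans hL') (by simpa using hR.trans hR')
    simp only [List.append_assoc, List.cons_append, List.nil_append] at h
    exact h.trans hmove.symm

end BaxterEquiv

/-- Two words are Baxter equivalent iff they have the same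
Baxter P-symbol. -/
theorem baxterEquiv_iff_psymb_eq {A : Type*} [LinearOrder A] (u v : List A) :
    BaxterEquiv u v ↔ (PsymbL u = PsymbL v ∧ PsymbR u = PsymbR v) :=
  ⟨BaxterEquiv.psymb_eq, fun h => BaxterEquiv.of_psymb_eq_append [] u v h.1 h.2⟩
end

section
/- Let (T_L, T_R) be a non-empty pair of twin binary trees. If the root of T_L is the i-th node of T_L in inorder, then the i-th node of T_R has no child (both its subtrees are empty). -/
namespace BTree

/-- The subtree rooted at the `i`-th node of the tree in inorder (1-based), if any. -/
def subtreeAt : BTree → ℕ → Option BTree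
  | leaf, _ => none
  | node l r, i =>
      if i = l.size + 1 then some (node l r)
      else if i ≤ l.size then l.subtreeAt i
      else r.subtreeAt (i - (l.size + 1))

end BTree

namespace BTree

theorem length_orients (t : BTree) :
    t.orients.length = if t.isLeaf then 0 else t.size + 1 := by
  induction t with
  | leaf => rfl
  | node l r hl hr => cases l <;> cases r <;> simp_all [orients, size, isLeaf] <;> omega

theorem length_left_orients (l : BTree) :
    (if l.isLeaf then [true] else l.orients).length = l.size + 1 := by
  have h := length_orients l
  cases l <;> simp_all [isLeaf, size]

theorem orients_first (l r : BTree) : (node l r).orients[0]? = some true := by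
  induction l generalizing r with
  | leaf => simp [orients, isLeaf]
  | node a b ha _ =>
    have h := length_orients (node a b)
    rw [orients, List.getElem?_append_left (by simp_all [isLeaf])]
    simpa [isLeaf] using ha b

theorem orients_last (l r : BTree) :
    (node l r).orients[l.size + r.size + 1]? = some false := by
  induction r generalizing l with
  | leaf =>
    have hlen := length_left_orients l
    rw [orients, List.getElem?_append_right (by simp only [size]; omega), hlen]
    simp [isLeaf, size]
  | node a b _ hb =>
    have hlen := length_left_orients l
    rw [orients, List.getElem?_append_right (by omega), hlen]
    simp only [isLeaf, size]
    rw [show l.size + (a.size + b.size + 1) + 1 - (l.size + 1) = a.size + b.size + 1 by omega]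
    simpa using hb a

/-- The `k+1`-st node of a tree exists, and the two leaves surrounding it in inorder tell whether
its two subtrees are empty. -/
theorem exists_subtreeAt (t : BTree) (k : ℕ) (hk : k < t.size) :
    ∃ a b, t.subtreeAt (k + 1) = some (node a b) ∧
      t.orients[k]? = some a.isLeaf ∧ t.orients[k + 1]? = some (!b.isLeaf) := by
  induction t generalizing k with
  | leaf => simp [size] at hk
  | node l r hl hr =>
    have hlen := length_left_orients l
    rcases lt_trichotomy k l.size with hlt | rfl | hgt
    · obtain ⟨a, b, h, h₀, h₁⟩ := hl k hlt
      refine ⟨a, b, ?_, ?_, ?_⟩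
      · rw [subtreeAt, if_neg (by omega), if_pos (by omega), h]
      all_goals
        rw [orients, List.getElem?_append_left (by omega)]
        cases l <;> simp_all [isLeaf, size]
    · refine ⟨l, r, by simp [subtreeAt], ?_, ?_⟩
      · rw [orients, List.getElem?_append_left (by omega)]
        cases l with
        | leaf => simp [isLeaf, size]
        | node a b => simpa [isLeaf, size] using orients_last a b
      · rw [orients, List.getElem?_append_right (by omega), hlen, Nat.sub_self]
        cases r with
        | leaf => simp [isLeaf]
        | node a b => simpa [isLeaf] using orients_first a b
    · obtain ⟨m, rfl⟩ : ∃ m, k = l.size + 1 + m := ⟨k - (l.size + 1), by omega⟩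
      obtain ⟨a, b, h, h₀, h₁⟩ := hr m (by simp only [size] at hk; omega)
      refine ⟨a, b, ?_, ?_, ?_⟩
      · rw [subtreeAt, if_neg (by omega), if_neg (by omega), ← h]
        congr 1
        omega
      · rw [orients, List.getElem?_append_right (by omega), hlen, Nat.add_sub_cancel_left]
        cases r with
        | leaf => simp [orients] at h₀
        | node c d => simpa [isLeaf] using h₀
      · rw [orients, List.getElem?_append_right (by omega), hlen, add_assoc,
          Nat.add_sub_cancel_left]
        cases r with
        | leaf => simp [orients] at h₀
        | node c d => simpa [isLeaf] using h₁

theorem getElem?_canopy (t : BTree) (j : ℕ) (hj : j + 1 < t.size) :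
    t.canopy[j]? = t.orients[j + 1]? := by
  have h := length_orients t
  cases t with
  | leaf => simp [size] at hj
  | node l r =>
    simp only [isLeaf, Bool.false_eq_true, if_false] at h
    rw [canopy, List.getElem?_dropLast, List.length_drop, h, if_pos (by omega),
      List.getElem?_drop, add_comm]

end BTree

open BTree in
theorem TwinPair.orients_ne {L R : BTree} (h : TwinPair L R) {j : ℕ} {b b' : Bool}
    (hj₀ : j ≠ 0) (hj : j < L.size) (hL : L.orients[j]? = some b)
    (hR : R.orients[j]? = some b') : b ≠ b' := by
  obtain ⟨j, rfl⟩ := Nat.exists_eq_succ_of_ne_zero hj₀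
  exact h.2 j b b' ((getElem?_canopy L j hj).trans hL)
    ((getElem?_canopy R j (h.1 ▸ hj)).trans hR)

/-- Let `(T_L, T_R)` be a non-empty pair of twin binary trees.
If the root of `T_L` is its `i`-th node in inorder (so `i = size(l) + 1` where
`l` is the left subtree of `T_L`), then the `i`-th node of `T_R` has no child. -/
theorem twin_root_index_childless (l r R : BTree)
    (h : TwinPair (BTree.node l r) R) :
    R.subtreeAt (l.size + 1) = some (BTree.node BTree.leaf BTree.leaf) := by
  have hsize : l.size + r.size + 1 = R.size := h.1
  obtain ⟨a', b', hroot, hl, hr⟩ :=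
    BTree.exists_subtreeAt (.node l r) l.size (by simp only [BTree.size]; omega)
  obtain ⟨rfl, rfl⟩ : l = a' ∧ r = b' := by simpa [BTree.subtreeAt] using hroot
  obtain ⟨a, b, hab, ha, hb⟩ := BTree.exists_subtreeAt R l.size (by omega)
  have ha' : a.isLeaf = true := by
    cases l with
    | leaf =>
      cases R with
      | leaf => simp [BTree.size] at hsize
      | node c d =>
        have hfirst := BTree.orients_first c d
        simp only [BTree.size] at ha
        simpa [hfirst] using ha.symm
    | node c d =>
      simpa [BTree.isLeaf] using
        h.orients_ne (by simp [BTree.size]) (by simp only [BTree.size]; omega) hl ha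
  have hb' : b.isLeaf = true := by
    cases r with
    | leaf =>
      cases R with
      | leaf => simp [BTree.size] at hsize
      | node c d =>
        have hlast := BTree.orients_last c d
        simp only [BTree.size, add_zero] at hsize
        rw [← hsize, hb] at hlast
        simpa using hlast
    | node c d =>
      simpa [BTree.isLeaf] using
        h.orients_ne (Nat.succ_ne_zero _) (by simp only [BTree.size]; omega) hr hb
  cases a <;> cases b <;> simp_all [BTree.isLeaf]
end

section
/- For any n ≥ 0, each ≡_B-equivalence class of permutations of size n contains exactly one Baxter permutation. -/
/-- A Baxter permutation: a permutation avoiding the generalized patterns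
`2-41-3` and `3-14-2`. Positions are 0-based: there are no positions
`i < j` and `j + 1 < k < |σ|` with `σ_{j+1} < σ_i < σ_k < σ_j` or
`σ_j < σ_k < σ_i < σ_{j+1}`. -/
def IsBaxterPerm (σ : List ℕ) : Prop :=
  ¬ ∃ (i j k a b c d : ℕ), i < j ∧ j + 1 < k ∧ k < σ.length ∧
      σ[i]? = some a ∧ σ[j]? = some b ∧ σ[j + 1]? = some c ∧ σ[k]? = some d ∧
      ((c < a ∧ a < d ∧ d < b) ∨ (b < d ∧ d < a ∧ a < c))

section BaxterWords

variable {A : Type*}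

theorem pair_sublist_swap {p q e f : A} {x y : List A} (h : [p, q].Sublist (x ++ e :: f :: y)) :
    [p, q].Sublist (x ++ f :: e :: y) ∨ (p = e ∧ q = f) := by
  induction x with
  | nil =>
    simp only [List.nil_append, List.sublist_cons_iff] at h ⊢
    grind
  | cons z x ih =>
    simp only [List.cons_append, List.sublist_cons_iff (a := z)] at h ⊢
    rcases h with h | ⟨r, hr, h⟩
    · rcases ih h with h | h
      · exact .inl (.inl h)
      · exact .inr h
    · left; right
      refine ⟨r, hr, ?_⟩
      simp only [List.cons.injEq] at hr
      obtain ⟨-, rfl⟩ := hr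
      simp only [List.singleton_sublist, List.mem_append, List.mem_cons] at h ⊢
      tauto

theorem pair_sublist_right_of_append {s t : List A} {a q : A}
    (hnd : (s ++ a :: t).Nodup) (h : [a, q].Sublist (s ++ a :: t)) : q ∈ t := by
  induction s with
  | nil =>
    simp only [List.nil_append, List.nodup_cons] at hnd
    simp only [List.nil_append, List.sublist_cons_iff] at h
    rcases h with h | ⟨r, hr, h⟩
    · exact absurd (h.subset (by simp)) hnd.1
    · obtain ⟨-, rfl⟩ := List.cons_eq_cons.1 hr
      exact List.singleton_sublist.1 h
  | cons z s ih =>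
    simp only [List.cons_append, List.nodup_cons] at hnd
    simp only [List.cons_append, List.sublist_cons_iff (a := z)] at h
    rcases h with h | ⟨r, hr, h⟩
    · exact ih hnd.2 h
    · obtain ⟨rfl, -⟩ := List.cons_eq_cons.1 hr
      simp at hnd

theorem pair_sublist_left_of_append {s t : List A} {p a : A}
    (hnd : (s ++ a :: t).Nodup) (h : [p, a].Sublist (s ++ a :: t)) : p ∈ s := by
  have hnd' : (t.reverse ++ a :: s.reverse).Nodup := by
    simpa using List.nodup_reverse.2 hnd
  have h' : [a, p].Sublist (t.reverse ++ a :: s.reverse) := by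
    simpa using h.reverse
  exact List.mem_reverse.1 (pair_sublist_right_of_append hnd' h')

variable [LinearOrder A]

/-- Exchange of two adjacent letters `a < d` such that some letter to their left and some letter
to their right have values strictly between `a` and `d`. -/
inductive BetweenSwap : List A → List A → Prop
  | mk (x y : List A) (a d p q : A) (hp : p ∈ x) (hq : q ∈ y) (hap : a < p) (hpd : p < d)
      (haq : a < q) (hqd : q < d) : BetweenSwap (x ++ a :: d :: y) (x ++ d :: a :: y)

/-- A word avoiding `2-41-3` and `3-14-2`, phrased through factorizations. -/
def IsBaxterWord (σ : List A) : Prop :=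
  ∀ x e f y, σ = x ++ e :: f :: y → ∀ p ∈ x, ∀ q ∈ y,
    ¬ (f < p ∧ p < q ∧ q < e) ∧ ¬ (e < q ∧ q < p ∧ p < f)

theorem isBaxterPerm_iff_isBaxterWord (σ : List ℕ) : IsBaxterPerm σ ↔ IsBaxterWord σ := by
  constructor
  · rintro h x e f y rfl p hp q hq
    obtain ⟨i, hi, rfl⟩ := List.getElem_of_mem hp
    obtain ⟨k, hk, rfl⟩ := List.getElem_of_mem hq
    by_contra hc
    refine h ⟨i, x.length, x.length + 2 + k, x[i], e, f, y[k], hi, by omega, by simp; omega,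
      ?_, ?_, ?_, ?_, ?_⟩
    · rw [List.getElem?_append_left hi, List.getElem?_eq_getElem hi]
    · simp
    · simp
    · rw [List.getElem?_append_right (by omega)]
      have : x.length + 2 + k - x.length = k + 2 := by omega
      simp [this]
    · tauto
  · rintro h ⟨i, j, k, a, b, c, d, hij, hjk, hk, hi, hj, hj1, hkd, hc⟩
    have hsplit : σ = σ.take j ++ b :: c :: σ.drop (j + 2) := by
      obtain ⟨h1, rfl⟩ := List.getElem?_eq_some_iff.1 hj
      obtain ⟨h2, rfl⟩ := List.getElem?_eq_some_iff.1 hj1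
      rw [List.getElem_cons_drop, List.getElem_cons_drop, List.take_append_drop]
    have ha : a ∈ σ.take j := by
      apply List.mem_of_getElem? (i := i)
      rw [List.getElem?_take_of_lt hij, hi]
    have hd : d ∈ σ.drop (j + 2) := by
      apply List.mem_of_getElem? (i := k - (j + 2))
      rw [List.getElem?_drop, ← hkd]
      congr 1
      omega
    have := h _ _ _ _ hsplit a ha d hd
    tauto

theorem BaxterEquiv.perm_s16 {σ τ : List A} (h : BaxterEquiv σ τ) : σ.Perm τ := by
  induction h with
  | refl u => exact .refl u
  | symm _ ih => exact ih.symm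
  | trans _ _ ih₁ ih₂ => exact ih₁.trans ih₂
  | rel1 x u v y a b c d =>
    simp only [List.append_assoc, List.cons_append]
    exact ((((List.Perm.swap d a _).append_left u).cons c).append_left x)
  | rel2 x u v y a b c d =>
    simp only [List.append_assoc, List.cons_append]
    exact ((((List.Perm.swap a d _).append_left u).cons b).append_left x)

theorem BetweenSwap.baxterEquiv {σ τ : List A} (h : BetweenSwap σ τ) : BaxterEquiv σ τ := by
  obtain ⟨x, y, a, d, p, q, hp, hq, hap, hpd, haq, hqd⟩ := h
  obtain ⟨x₁, x₂, rfl⟩ := List.append_of_mem hp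
  obtain ⟨y₁, y₂, rfl⟩ := List.append_of_mem hq
  rcases le_or_gt p q with hpq | hqp
  · simpa using (BaxterEquiv.rel2 x₁ x₂ y₁ y₂ a p q d hap hpq hqd).symm
  · simpa using BaxterEquiv.rel1 x₁ x₂ y₁ y₂ a q p d haq.le hqp hpd.le

theorem BaxterEquiv.eqvGen_betweenSwap {σ τ : List A} (h : BaxterEquiv σ τ) (hσ : σ.Nodup) :
    Relation.EqvGen BetweenSwap σ τ := by
  induction h with
  | refl u => exact .refl u
  | symm h ih => exact .symm _ _ (ih (h.perm_s16.nodup_iff.2 hσ))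
  | trans h _ ih₁ ih₂ => exact .trans _ _ _ (ih₁ hσ) (ih₂ (h.perm_s16.nodup_iff.1 hσ))
  | rel1 x u v y a b c d hab hbc hcd =>
    have hab' : a ≠ b := by rintro rfl; simp [List.nodup_append] at hσ
    have hcd' : c ≠ d := by rintro rfl; simp [List.nodup_append] at hσ
    have hab := lt_of_le_of_ne hab hab'
    have hcd := lt_of_le_of_ne hcd hcd'
    have := BetweenSwap.mk (x ++ c :: u) (v ++ b :: y) a d c b (by simp) (by simp)
      (hab.trans hbc) hcd hab (hbc.trans hcd)
    simpa using Relation.EqvGen.rel _ _ this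
  | rel2 x u v y a b c d hab hbc hcd =>
    have := BetweenSwap.mk (x ++ b :: u) (v ++ c :: y) a d b c (by simp) (by simp)
      hab (hbc.trans_lt hcd) (hab.trans_le hbc) hcd
    simpa using Relation.EqvGen.symm _ _ (Relation.EqvGen.rel _ _ this)

theorem BaxterEquiv.filter_lt {σ τ : List A} (h : BaxterEquiv σ τ) (N : A) :
    BaxterEquiv (σ.filter (· < N)) (τ.filter (· < N)) := by
  induction h with
  | refl u => exact .refl _
  | symm _ ih => exact ih.symm
  | trans _ _ ih₁ ih₂ => exact ih₁.trans ih₂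
  | rel1 x u v y a b c d hab hbc hcd =>
    by_cases hd : d < N
    · have hc := hcd.trans_lt hd
      have hb := hbc.trans hc
      have ha := hab.trans_lt hb
      simpa [List.filter_cons, ha, hb, hc, hd] using
        BaxterEquiv.rel1 (x.filter (· < N)) (u.filter (· < N)) (v.filter (· < N))
          (y.filter (· < N)) a b c d hab hbc hcd
    · simp only [List.filter_append, List.filter_cons, hd, decide_false, Bool.false_eq_true,
        if_false]
      exact .refl _
  | rel2 x u v y a b c d hab hbc hcd =>
    by_cases hd : d < N
    · have hc := hcd.trans hd
      have hb := hbc.trans_lt hc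
      have ha := hab.trans hb
      simpa [List.filter_cons, ha, hb, hc, hd] using
        BaxterEquiv.rel2 (x.filter (· < N)) (u.filter (· < N)) (v.filter (· < N))
          (y.filter (· < N)) a b c d hab hbc hcd
    · simp only [List.filter_append, List.filter_cons, hd, decide_false, Bool.false_eq_true,
        if_false]
      exact .refl _

/-- Some letter with value strictly between `a` and `b` occurs before `a`. -/
def HasBetweenLeft (σ : List A) (a b : A) : Prop := ∃ p, a < p ∧ p < b ∧ [p, a].Sublist σ

/-- Some letter with value strictly between `a` and `b` occurs after `a`. -/
def HasBetweenRight (σ : List A) (a b : A) : Prop := ∃ p, a < p ∧ p < b ∧ [a, p].Sublist σ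

theorem BetweenSwap.hasBetweenLeft_iff {σ τ : List A} (h : BetweenSwap σ τ) (a b : A) :
    HasBetweenLeft σ a b ↔ HasBetweenLeft τ a b := by
  obtain ⟨x, y, e, f, p, q, hp, hq, hap, hpd, haq, hqd⟩ := h
  constructor
  · rintro ⟨r, har, hrb, hs⟩
    rcases pair_sublist_swap hs with h | ⟨rfl, rfl⟩
    · exact ⟨r, har, hrb, h⟩
    · exact absurd (hap.trans hpd) har.not_gt
  · rintro ⟨r, har, hrb, hs⟩
    rcases pair_sublist_swap hs with h | ⟨rfl, rfl⟩
    · exact ⟨r, har, hrb, h⟩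
    · refine ⟨p, hap, hpd.trans hrb, ?_⟩
      exact (List.singleton_sublist.2 hp).append (List.singleton_sublist.2 (by simp))

theorem BetweenSwap.hasBetweenRight_iff {σ τ : List A} (h : BetweenSwap σ τ) (a b : A) :
    HasBetweenRight σ a b ↔ HasBetweenRight τ a b := by
  obtain ⟨x, y, e, f, p, q, hp, hq, hap, hpd, haq, hqd⟩ := h
  constructor
  · rintro ⟨r, har, hrb, hs⟩
    rcases pair_sublist_swap hs with h | ⟨rfl, rfl⟩
    · exact ⟨r, har, hrb, h⟩
    · refine ⟨q, haq, hqd.trans hrb, ?_⟩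
      refine List.Sublist.trans ?_ (List.sublist_append_right x _)
      exact ((List.singleton_sublist.2 hq).cons_cons a).cons r
  · rintro ⟨r, har, hrb, hs⟩
    rcases pair_sublist_swap hs with h | ⟨rfl, rfl⟩
    · exact ⟨r, har, hrb, h⟩
    · exact absurd (hap.trans hpd) har.not_gt

theorem BetweenSwap.pair_sublist_iff {σ τ : List A} (h : BetweenSwap σ τ) {a b : A}
    (hn : ¬ (HasBetweenLeft σ a b ∧ HasBetweenRight σ a b)) (hab : a < b) :
    [a, b].Sublist σ ↔ [a, b].Sublist τ := by
  rw [h.hasBetweenRight_iff] at hn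
  obtain ⟨x, y, e, f, p, q, hp, hq, hap, hpd, haq, hqd⟩ := h
  constructor
  · intro hs
    rcases pair_sublist_swap hs with h | ⟨rfl, rfl⟩
    · exact h
    · refine absurd ⟨⟨p, hap, hpd, ?_⟩, ⟨q, haq, hqd, ?_⟩⟩ hn
      · exact (List.singleton_sublist.2 hp).append (List.singleton_sublist.2 (by simp))
      · refine List.Sublist.trans ?_ (List.sublist_append_right x _)
        exact ((List.singleton_sublist.2 hq).cons_cons a).cons b
  · intro hs
    rcases pair_sublist_swap hs with h | ⟨rfl, rfl⟩
    · exact h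
    · exact absurd (hap.trans hpd) hab.not_gt

theorem between_invariant {σ τ : List A} (h : Relation.EqvGen BetweenSwap σ τ) {a b : A}
    (hab : a < b) :
    (HasBetweenLeft σ a b ↔ HasBetweenLeft τ a b) ∧
    (HasBetweenRight σ a b ↔ HasBetweenRight τ a b) ∧
    (¬ (HasBetweenLeft σ a b ∧ HasBetweenRight σ a b) →
      ([a, b].Sublist σ ↔ [a, b].Sublist τ)) := by
  induction h with
  | rel _ _ h =>
    exact ⟨h.hasBetweenLeft_iff a b, h.hasBetweenRight_iff a b, fun hn => h.pair_sublist_iff hn hab⟩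
  | refl _ => simp
  | symm _ _ _ ih =>
    obtain ⟨hL, hR, hS⟩ := ih
    exact ⟨hL.symm, hR.symm, fun hn => (hS (by rwa [hL, hR])).symm⟩
  | trans _ _ _ _ _ ih₁ ih₂ =>
    obtain ⟨hL, hR, hS⟩ := ih₁
    exact ⟨hL.trans ih₂.1, hR.trans ih₂.2.1,
      fun hn => (hS hn).trans (ih₂.2.2 (by rwa [← hL, ← hR]))⟩

theorem IsBaxterWord.of_insert_max {u v : List A} {N : A} (h : IsBaxterWord (u ++ N :: v))
    (hN : ∀ z ∈ u ++ v, z < N) : IsBaxterWord (u ++ v) := by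
  intro x e f y hs p hp q hq
  have hpN : p < N := hN p (by rw [hs]; simp [hp])
  have hqN : q < N := hN q (by rw [hs]; simp [hq])
  rcases List.append_eq_append_iff.1 hs with ⟨w, rfl, rfl⟩ | ⟨w, rfl, hw⟩
  · exact h (u ++ N :: w) e f y (by simp) p
      (by simp only [List.mem_append, List.mem_cons] at hp ⊢; tauto) q hq
  · match w, hw with
    | [], hw =>
      simp only [List.nil_append] at hw
      subst hw
      exact h (x ++ [N]) e f y (by simp) p (by simp [hp]) q hq
    | [e'], hw =>
      simp only [List.cons_append, List.nil_append, List.cons.injEq] at hw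
      obtain ⟨rfl, rfl⟩ := hw
      have h₁ := (h (x ++ [e]) N f y (by simp) p (by simp [hp]) q hq).1
      have h₂ := (h x e N (f :: y) (by simp) p hp q (by simp [hq])).2
      exact ⟨fun hc => h₁ ⟨hc.1, hc.2.1, hqN⟩, fun hc => h₂ ⟨hc.1, hc.2.1, hpN⟩⟩
    | e' :: f' :: w, hw =>
      simp only [List.cons_append, List.cons.injEq] at hw
      obtain ⟨rfl, rfl, rfl⟩ := hw
      exact h x e f (w ++ N :: v) (by simp) p hp q
        (by simp only [List.mem_append, List.mem_cons] at hq ⊢; tauto)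

theorem IsBaxterWord.insert_max {u v : List A} {N : A} (h : IsBaxterWord (u ++ v))
    (hN : ∀ z ∈ u ++ v, z < N)
    (hr : ∀ f y, v = f :: y → ∀ p ∈ u, ∀ q ∈ y, ¬ (f < p ∧ p < q))
    (hl : ∀ x e, u = x ++ [e] → ∀ p ∈ x, ∀ q ∈ v, ¬ (e < q ∧ q < p)) :
    IsBaxterWord (u ++ N :: v) := by
  intro x e f y hs p hp q hq
  rcases List.append_eq_append_iff.1 hs with ⟨w, rfl, hw⟩ | ⟨w, rfl, hw⟩
  · cases w with
    | nil =>
      simp only [List.nil_append, List.cons.injEq] at hw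
      obtain ⟨rfl, rfl⟩ := hw
      have h₁ := hr f y rfl p (by simpa using hp) q hq
      have h₂ := hN f (by simp)
      have h₃ := hN q (by simp [hq])
      exact ⟨by tauto, fun hc => absurd hc.1 h₃.not_gt⟩
    | cons N' w =>
      simp only [List.cons_append, List.cons.injEq] at hw
      obtain ⟨rfl, rfl⟩ := hw
      simp only [List.mem_append, List.mem_cons] at hp
      have he := hN e (by simp)
      have hf := hN f (by simp)
      by_cases hpN : p = N
      · subst hpN
        exact ⟨fun hc => absurd (hc.2.1.trans hc.2.2) he.not_gt, fun hc => absurd hc.2.2 hf.not_gt⟩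
      · exact h (u ++ w) e f y (by simp) p (by simp only [List.mem_append]; tauto) q hq
  · match w, hw with
    | [], hw =>
      simp only [List.nil_append, List.cons.injEq] at hw
      obtain ⟨rfl, rfl⟩ := hw
      have h₁ := hr f y rfl p (by simpa using hp) q hq
      have h₃ := hN q (by simp [hq])
      exact ⟨by tauto, fun hc => absurd hc.1 h₃.not_gt⟩
    | [e'], hw =>
      simp only [List.cons_append, List.nil_append, List.cons.injEq] at hw
      obtain ⟨rfl, rfl, rfl⟩ := hw
      have h₁ := hl x e rfl p hp q hq
      have h₃ := hN p (by simp [hp])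
      exact ⟨fun hc => absurd hc.1 h₃.not_gt, by tauto⟩
    | e' :: f' :: w, hw =>
      simp only [List.cons_append, List.cons.injEq] at hw
      obtain ⟨rfl, rfl, rfl⟩ := hw
      simp only [List.mem_append, List.mem_cons] at hq
      have he := hN e (by simp)
      have hf := hN f (by simp)
      by_cases hqN : q = N
      · subst hqN
        exact ⟨fun hc => absurd hc.2.2 he.not_gt, fun hc => absurd (hc.2.1.trans hc.2.2) hf.not_gt⟩
      · exact h x e f (w ++ v) (by simp) p hp q (by simp only [List.mem_append]; tauto)

/-- A swap lifts along the insertion of a letter larger than all others. -/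
theorem BetweenSwap.insert_max {σ τ : List A} (h : BetweenSwap σ τ) {N : A}
    (hN : ∀ z ∈ σ, z < N) :
    (∀ u v, u ++ v = σ → ∃ u' v', u' ++ v' = τ ∧ BaxterEquiv (u ++ N :: v) (u' ++ N :: v')) ∧
    (∀ u v, u ++ v = τ → ∃ u' v', u' ++ v' = σ ∧ BaxterEquiv (u ++ N :: v) (u' ++ N :: v')) := by
  obtain ⟨x, y, a, d, p, q, hp, hq, hap, hpd, haq, hqd⟩ := h
  have hpN : p < N := hN p (by simp [hp])
  have hqN : q < N := hN q (by simp [hq])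
  have inLeft (w z : List A) (hx : x = w ++ z) :
      BaxterEquiv (w ++ N :: (z ++ a :: d :: y)) (w ++ N :: (z ++ d :: a :: y)) := by
    have := BetweenSwap.mk (w ++ N :: z) y a d p q
      (by simp only [hx, List.mem_append, List.mem_cons] at hp ⊢; tauto) hq hap hpd haq hqd
    simpa using this.baxterEquiv
  have inRight (w z : List A) (hy : y = w ++ z) :
      BaxterEquiv (x ++ a :: d :: w ++ N :: z) (x ++ d :: a :: w ++ N :: z) := by
    have := BetweenSwap.mk x (w ++ N :: z) a d p q hp
      (by simp only [hy, List.mem_append, List.mem_cons] at hq ⊢; tauto) hap hpd haq hqd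
    simpa using this.baxterEquiv
  constructor
  · intro u v hs
    rcases List.append_eq_append_iff.1 hs with ⟨w, hx, rfl⟩ | ⟨w, rfl, hw⟩
    · exact ⟨u, w ++ d :: a :: y, by simp [hx], inLeft u w hx⟩
    · match w, hw with
      | [], hw =>
        simp only [List.nil_append] at hw
        subst hw
        exact ⟨x, d :: a :: y, by simp, by simpa using inLeft x [] (by simp)⟩
      | [a'], hw =>
        simp only [List.cons_append, List.nil_append, List.cons.injEq] at hw
        obtain ⟨rfl, rfl⟩ := hw
        refine ⟨x, d :: a :: y, by simp, BaxterEquiv.trans ?_ (inLeft x [] (by simp))⟩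
        have := BetweenSwap.mk x (d :: y) a N p q hp (by simp [hq]) hap hpN haq hqN
        simpa using this.baxterEquiv
      | a' :: d' :: w, hw =>
        simp only [List.cons_append, List.cons.injEq] at hw
        obtain ⟨rfl, rfl, hy⟩ := hw
        exact ⟨x ++ d :: a :: w, v, by simp [hy], inRight w v hy⟩
  · intro u v hs
    rcases List.append_eq_append_iff.1 hs with ⟨w, hx, rfl⟩ | ⟨w, rfl, hw⟩
    · exact ⟨u, w ++ a :: d :: y, by simp [hx], (inLeft u w hx).symm⟩
    · match w, hw with
      | [], hw =>
        simp only [List.nil_append] at hw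
        subst hw
        exact ⟨x, a :: d :: y, by simp, by simpa using (inLeft x [] (by simp)).symm⟩
      | [d'], hw =>
        simp only [List.cons_append, List.nil_append, List.cons.injEq] at hw
        obtain ⟨rfl, rfl⟩ := hw
        refine ⟨x ++ [a, d], y, by simp,
          BaxterEquiv.trans ?_ (by simpa using (inRight [] y (by simp)).symm)⟩
        have := BetweenSwap.mk (x ++ [d]) y a N p q (by simp [hp]) hq hap hpN haq hqN
        simpa using this.baxterEquiv.symm
      | d' :: a' :: w, hw =>
        simp only [List.cons_append, List.cons.injEq] at hw
        obtain ⟨rfl, rfl, hy⟩ := hw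
        exact ⟨x ++ a :: d :: w, v, by simp [hy], (inRight w v hy).symm⟩

theorem eqvGen_insert_max {σ τ : List A} (h : Relation.EqvGen BetweenSwap σ τ) {N : A}
    (hN : ∀ z ∈ σ, z < N) :
    (∀ z ∈ τ, z < N) ∧
    (∀ u v, u ++ v = σ → ∃ u' v', u' ++ v' = τ ∧ BaxterEquiv (u ++ N :: v) (u' ++ N :: v')) := by
  suffices H : ((∀ z ∈ σ, z < N) ↔ ∀ z ∈ τ, z < N) ∧ ((∀ z ∈ σ, z < N) →
    (∀ u v, u ++ v = σ → ∃ u' v', u' ++ v' = τ ∧ BaxterEquiv (u ++ N :: v) (u' ++ N :: v')) ∧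
    (∀ u v, u ++ v = τ → ∃ u' v', u' ++ v' = σ ∧ BaxterEquiv (u ++ N :: v) (u' ++ N :: v'))) from
    ⟨H.1.1 hN, (H.2 hN).1⟩
  clear hN
  induction h with
  | rel _ _ h =>
    exact ⟨by simp only [h.baxterEquiv.perm_s16.mem_iff], fun hN => h.insert_max hN⟩
  | refl σ =>
    exact ⟨Iff.rfl, fun _ => ⟨fun u v h => ⟨u, v, h, .refl _⟩, fun u v h => ⟨u, v, h, .refl _⟩⟩⟩
  | symm _ _ _ ih => exact ⟨ih.1.symm, fun hN => (ih.2 (ih.1.2 hN)).symm⟩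
  | trans _ _ _ _ _ ih₁ ih₂ =>
    refine ⟨ih₁.1.trans ih₂.1, fun hN => ?_⟩
    have h₁ := ih₁.2 hN
    have h₂ := ih₂.2 (ih₁.1.1 hN)
    constructor
    · intro u v hs
      obtain ⟨u', v', hs', h'⟩ := h₁.1 u v hs
      obtain ⟨u'', v'', hs'', h''⟩ := h₂.1 u' v' hs'
      exact ⟨u'', v'', hs'', h'.trans h''⟩
    · intro u v hs
      obtain ⟨u', v', hs', h'⟩ := h₂.2 u v hs
      obtain ⟨u'', v'', hs'', h''⟩ := h₁.2 u' v' hs'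
      exact ⟨u'', v'', hs'', h'.trans h''⟩

/-- A maximal letter located left of the maximum `M` of the other letters can be moved right
until the next letter dominates its prefix. -/
theorem exists_move_max_right {M N : A} (hMN : M < N) (u v : List A) (hM : M ∈ v)
    (hle : ∀ z ∈ u ++ v, z ≤ M) :
    ∃ u' f y, u' ++ f :: y = u ++ v ∧ BaxterEquiv (u ++ N :: v) (u' ++ N :: f :: y) ∧
      ∀ p ∈ u', p ≤ f := by
  induction v generalizing u with
  | nil => simp at hM
  | cons f y ih =>
    by_cases hf : ∀ p ∈ u, p ≤ f
    · exact ⟨u, f, y, rfl, .refl _, hf⟩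
    · push Not at hf
      obtain ⟨p, hp, hfp⟩ := hf
      have hpM : p ≤ M := hle p (by simp [hp])
      have hfM : f < M := hfp.trans_le hpM
      have hMy : M ∈ y := by
        rcases List.mem_cons.1 hM with rfl | h
        · exact absurd hfM (lt_irrefl _)
        · exact h
      obtain ⟨u', f', y', hs, he, hd⟩ := ih (u ++ [f]) hMy (by simpa using hle)
      refine ⟨u', f', y', by simpa using hs, BaxterEquiv.trans ?_ he, hd⟩
      have := BetweenSwap.mk u y f N p M hp hMy hfp (hpM.trans_lt hMN) hfM hMN
      simpa using this.baxterEquiv.symm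

/-- A maximal letter located right of the maximum `M` of the other letters can be moved left
until the preceding letter dominates its suffix. -/
theorem exists_move_max_left {M N : A} (hMN : M < N) (u v : List A) (hM : M ∈ u)
    (hle : ∀ z ∈ u ++ v, z ≤ M) :
    ∃ x e v', x ++ e :: v' = u ++ v ∧ BaxterEquiv (u ++ N :: v) (x ++ e :: N :: v') ∧
      ∀ q ∈ v', q ≤ e := by
  induction u using List.reverseRecOn generalizing v with
  | nil => simp at hM
  | append_singleton x e ih =>
    by_cases he : ∀ q ∈ v, q ≤ e
    · exact ⟨x, e, v, by simp, by simpa using BaxterEquiv.refl _, he⟩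
    · push Not at he
      obtain ⟨q, hq, heq⟩ := he
      have hqM : q ≤ M := hle q (by simp [hq])
      have heM : e < M := heq.trans_le hqM
      have hMx : M ∈ x := by
        rcases List.mem_append.1 hM with h | h
        · exact h
        · exact absurd (List.mem_singleton.1 h) heM.ne'
      obtain ⟨x', e', v', hs, hequiv, hd⟩ := ih (e :: v) hMx (by simpa using hle)
      refine ⟨x', e', v', by simpa using hs, BaxterEquiv.trans ?_ hequiv, hd⟩
      have := BetweenSwap.mk x v e N M q hMx hq heM hMN heq (hqM.trans_lt hMN)
      simpa using this.baxterEquiv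

theorem exists_baxterEquiv_insert_max {u v : List A} {N : A} (h : IsBaxterWord (u ++ v))
    (hnd : (u ++ v).Nodup) (hN : ∀ z ∈ u ++ v, z < N) :
    ∃ ν, IsBaxterWord ν ∧ BaxterEquiv (u ++ N :: v) ν := by
  by_cases hne : u ++ v = []
  · obtain ⟨rfl, rfl⟩ := List.append_eq_nil_iff.1 hne
    exact ⟨_, h.insert_max hN (by simp) (by simp), .refl _⟩
  obtain ⟨M, hM, hle⟩ := (u ++ v).toFinset.exists_max_image id
    (by simpa [Finset.nonempty_iff_ne_empty] using hne)
  simp only [List.mem_toFinset, id] at hM hle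
  rcases List.mem_append.1 hM with hMu | hMv
  · obtain ⟨x, e, v', hs, he, hd⟩ := exists_move_max_left (hN M hM) u v hMu hle
    rw [← hs] at h hN hnd
    refine ⟨_, ?_, he⟩
    have key := IsBaxterWord.insert_max (u := x ++ [e]) (v := v') (N := N)
      (by simpa using h) (by simpa using hN) ?_ ?_
    · simpa using key
    · rintro f y rfl p hp q hq ⟨h₁, h₂⟩
      have hqe := hd q (by simp [hq])
      have hne : q ≠ e := by
        rintro rfl
        simp [List.nodup_append, hq] at hnd
      rcases List.mem_append.1 hp with hp | hp
      · exact (h x e f y rfl p hp q hq).1 ⟨h₁, h₂, lt_of_le_of_ne hqe hne⟩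
      · rw [List.mem_singleton.1 hp] at h₂
        exact absurd hqe h₂.not_ge
    · rintro x' e' hx p - q hq ⟨h₁, -⟩
      obtain ⟨-, rfl⟩ := List.append_inj' hx rfl |>.imp_right List.singleton_inj.1
      exact absurd (hd q hq) h₁.not_ge
  · obtain ⟨u', f, y, hs, he, hd⟩ := exists_move_max_right (hN M hM) u v hMv hle
    rw [← hs] at h hN hnd
    refine ⟨_, h.insert_max hN ?_ ?_, he⟩
    · rintro f' y' hv p hp q - ⟨h₁, -⟩
      obtain ⟨rfl, rfl⟩ := List.cons_eq_cons.1 hv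
      exact absurd (hd p hp) h₁.not_ge
    · rintro x e rfl p hp q hq ⟨h₁, h₂⟩
      have hpf := hd p (by simp [hp])
      have hne : p ≠ f := by
        rintro rfl
        simp [List.nodup_append] at hnd
        grind
      rcases List.mem_cons.1 hq with rfl | hq
      · exact absurd hpf h₂.not_ge
      · exact (h x e f y (by simp) p hp q hq).2 ⟨h₁, h₂, lt_of_le_of_ne hpf hne⟩

theorem exists_eq_append_max {σ : List A} (hne : σ ≠ []) (hnd : σ.Nodup) :
    ∃ u N v, σ = u ++ N :: v ∧ ∀ z ∈ u ++ v, z < N := by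
  obtain ⟨N, hN, hle⟩ := σ.toFinset.exists_max_image id
    (by simpa [Finset.nonempty_iff_ne_empty] using hne)
  simp only [List.mem_toFinset, id] at hN hle
  obtain ⟨u, v, rfl⟩ := List.append_of_mem hN
  refine ⟨u, N, v, rfl, fun z hz => lt_of_le_of_ne (hle z ?_) ?_⟩
  · simp only [List.mem_append, List.mem_cons] at hz ⊢
    tauto
  · rintro rfl
    exact (List.nodup_cons.1 (List.perm_middle.nodup_iff.1 hnd)).1 hz

theorem exists_isBaxterWord_baxterEquiv (σ : List A) (hnd : σ.Nodup) :
    ∃ ν, IsBaxterWord ν ∧ BaxterEquiv σ ν := by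
  induction hn : σ.length generalizing σ with
  | zero =>
    obtain rfl := List.length_eq_zero_iff.1 hn
    exact ⟨[], by simp [IsBaxterWord], .refl _⟩
  | succ n ih =>
    obtain ⟨u, N, v, rfl, hN⟩ := exists_eq_append_max (by rintro rfl; simp at hn) hnd
    have hnd' : (u ++ v).Nodup := (List.nodup_cons.1 (List.perm_middle.nodup_iff.1 hnd)).2
    obtain ⟨τ, hτ, he⟩ := ih (u ++ v) hnd' (by simp at hn ⊢; omega)
    obtain ⟨hN', hlift⟩ := eqvGen_insert_max (he.eqvGen_betweenSwap hnd') hN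
    obtain ⟨u', v', rfl, he'⟩ := hlift u v rfl
    obtain ⟨ν, hν, he''⟩ := exists_baxterEquiv_insert_max hτ (he.perm_s16.nodup_iff.1 hnd') hN'
    exact ⟨ν, hν, he'.trans he''⟩

/-- Two equivalent Baxter words that differ only by the place of their largest letter agree. -/
theorem eq_nil_of_baxterEquiv_insert_max {u w v : List A} {N : A}
    (hN : ∀ z ∈ u ++ w ++ v, z < N) (hnd : (u ++ N :: (w ++ v)).Nodup)
    (h₁ : IsBaxterWord (u ++ N :: (w ++ v))) (h₂ : IsBaxterWord (u ++ w ++ N :: v))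
    (he : BaxterEquiv (u ++ N :: (w ++ v)) (u ++ w ++ N :: v)) : w = [] := by
  by_contra hw
  have hnd₂ := he.perm_s16.nodup_iff.1 hnd
  have hnd₃ : (u ++ w ++ v).Nodup := (List.nodup_cons.1 (List.perm_middle.nodup_iff.1 hnd₂)).2
  have hbetween (a : A) (ha : a ∈ w) :
      HasBetweenLeft (u ++ N :: (w ++ v)) a N ∧ HasBetweenRight (u ++ w ++ N :: v) a N := by
    have haN : a < N := hN a (by simp [ha])
    obtain ⟨-, hR, hS⟩ := between_invariant (he.eqvGen_betweenSwap hnd) haN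
    rw [← hR]
    by_contra hc
    have hs := (hS hc).2 (((List.singleton_sublist.2 (List.mem_append_right u ha)).append
      (List.singleton_sublist.2 (by simp)) : [a, N].Sublist (u ++ w ++ N :: v)))
    have hau := pair_sublist_left_of_append hnd hs
    simp only [List.append_assoc] at hnd₃
    exact (List.nodup_append.1 hnd₃).2.2 a hau a (by simp [ha]) rfl
  obtain ⟨M, hM, hle⟩ := (u ++ w ++ v).toFinset.exists_max_image id
    (by simpa [Finset.nonempty_iff_ne_empty] using fun _ h => absurd h hw)
  simp only [List.mem_toFinset, id] at hM hle
  have hMw : M ∉ w := by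
    intro hMw
    obtain ⟨p, hMp, hpN, hs⟩ := (hbetween M hMw).1
    have hp := hs.subset (List.mem_cons_self (a := p))
    refine absurd (hle p ?_) hMp.not_ge
    have := hpN.ne
    simp only [List.mem_append, List.mem_cons] at hp ⊢
    tauto
  have hMuv : M ∈ u ∨ M ∈ v := by
    simp only [List.mem_append] at hM
    tauto
  rcases hMuv with hMu | hMv
  · obtain ⟨w', a, rfl⟩ := List.eq_nil_or_concat' w |>.resolve_left hw
    obtain ⟨q, haq, hqN, hs⟩ := (hbetween a (by simp)).2
    have hq := pair_sublist_right_of_append (s := u ++ w') (t := N :: v) (a := a)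
      (by simpa using hnd₂) (by simpa using hs)
    have hqv : q ∈ v := (List.mem_cons.1 hq).resolve_left hqN.ne
    have hqM : q < M := lt_of_le_of_ne (hle q (by simp [hqv])) fun h =>
      (List.nodup_append.1 hnd₃).2.2 M (by simp [hMu]) q hqv h.symm
    exact (h₂ (u ++ w') a N v (by simp) M (by simp [hMu]) q hqv).2 ⟨haq, hqM, hN M hM⟩
  · obtain ⟨a, w', rfl⟩ := List.exists_cons_of_ne_nil hw
    obtain ⟨p, hap, hpN, hs⟩ := (hbetween a (by simp)).1
    have hp := pair_sublist_left_of_append (s := u ++ [N]) (t := w' ++ v) (a := a)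
      (by simpa using hnd) (by simpa using hs)
    have hpu : p ∈ u := by
      have := hpN.ne
      simp only [List.mem_append, List.mem_singleton] at hp
      tauto
    have hpM : p < M := lt_of_le_of_ne (hle p (by simp [hpu])) fun h =>
      (List.nodup_append.1 hnd₃).2.2 p (by simp [hpu]) M hMv h
    exact (h₁ u N a (w' ++ v) (by simp) p hpu M (by simp [hMv])).1 ⟨hap, hpM, hN M hM⟩

theorem filter_lt_append_max {u v : List A} {N : A} (hN : ∀ z ∈ u ++ v, z < N) :
    (u ++ N :: v).filter (· < N) = u ++ v := by
  rw [List.filter_append, List.filter_cons]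
  simp only [lt_irrefl, decide_false, Bool.false_eq_true, if_false]
  rw [← List.filter_append, List.filter_eq_self.2]
  simpa using hN

theorem IsBaxterWord.eq_of_baxterEquiv {σ τ : List A} (hσ : IsBaxterWord σ) (hτ : IsBaxterWord τ)
    (hnd : σ.Nodup) (he : BaxterEquiv σ τ) : σ = τ := by
  induction hn : σ.length generalizing σ τ with
  | zero =>
    obtain rfl := List.length_eq_zero_iff.1 hn
    exact (List.nil_perm.1 he.perm_s16).symm
  | succ n ih =>
    obtain ⟨u, N, v, rfl, hN⟩ := exists_eq_append_max (by rintro rfl; simp at hn) hnd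
    have hnd₂ := he.perm_s16.nodup_iff.1 hnd
    obtain ⟨u', v', rfl⟩ := List.append_of_mem (he.perm_s16.subset (List.mem_append_right u
      (List.mem_cons_self (a := N))))
    have hperm : (u ++ v).Perm (u' ++ v') :=
      ((List.perm_middle.symm.trans he.perm_s16).trans List.perm_middle).cons_inv
    have hN' : ∀ z ∈ u' ++ v', z < N := fun z hz => hN z (hperm.mem_iff.2 hz)
    have hnd' : (u ++ v).Nodup := (List.nodup_cons.1 (List.perm_middle.nodup_iff.1 hnd)).2
    have he' := he.filter_lt N
    rw [filter_lt_append_max hN, filter_lt_append_max hN'] at he'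
    have heq := ih (hσ.of_insert_max hN) (hτ.of_insert_max hN') hnd' he'
      (by simp at hn ⊢; omega)
    rcases List.append_eq_append_iff.1 heq with ⟨w, rfl, rfl⟩ | ⟨w, rfl, rfl⟩
    · obtain rfl := eq_nil_of_baxterEquiv_insert_max hN' hnd hσ hτ he
      simp
    · obtain rfl := eq_nil_of_baxterEquiv_insert_max hN hnd₂ hτ hσ he.symm
      simp

end BaxterWords

/-- For any `n ≥ 0`, each `≡_B`-equivalence class of
permutations of size `n` contains exactly one Baxter permutation. -/
theorem baxterClass_unique_baxterPerm (n : ℕ) (σ : List ℕ) (hσ : IsPermWord n σ) :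
    ∃! ν : List ℕ, IsPermWord n ν ∧ IsBaxterPerm ν ∧ BaxterEquiv σ ν := by
  have hnd : σ.Nodup :=
    (List.Perm.nodup_iff hσ).2 (List.nodup_range.map fun _ _ h => Nat.succ_injective h)
  obtain ⟨ν, hν, he⟩ := exists_isBaxterWord_baxterEquiv σ hnd
  refine ⟨ν, ⟨he.perm_s16.symm.trans hσ, (isBaxterPerm_iff_isBaxterWord ν).2 hν, he⟩, ?_⟩
  rintro τ ⟨-, hτ, he'⟩
  exact ((isBaxterPerm_iff_isBaxterWord τ).1 hτ).eq_of_baxterEquiv hν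
    (he'.perm_s16.nodup_iff.1 hnd) (he'.symm.trans he)
end

section
/- For any n ≥ 0, the map (T_L, T_R) ↦ (td(T_L), td(T_R)) is a bijection from the set of pairs of twin binary trees with n nodes onto the set of twin Tamari diagrams of size n. -/
namespace BTree

/-- The Tamari diagram of a binary tree: its `i`-th letter is the number of nodes
of the right subtree of the `i`-th node of the tree in inorder. -/
def tdiag : BTree → List ℕ
  | leaf => []
  | node l r => tdiag l ++ r.size :: tdiag r

end BTree

/-- A Tamari diagram of length `n` (indices here are 0-based, so the 1-based
conditions `δ_i ≤ n − i` and `δ_{i+j} ≤ δ_i − j` for `1 ≤ j ≤ δ_i` become the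
conditions below). -/
def IsTamariDiagram (δ : List ℕ) : Prop :=
  (∀ (i x : ℕ), δ[i]? = some x → x + i + 1 ≤ δ.length) ∧
  (∀ (i j x y : ℕ), δ[i]? = some x → 1 ≤ j → j ≤ x → δ[i + j]? = some y → y + j ≤ x)

/-- A twin Tamari diagram: a pair of Tamari diagrams of the same length `n` such
that for every position `i` with `1 ≤ i ≤ n − 1` (0-based: `i + 1 < n`) exactly
one of the two letters at position `i` is zero. -/
def IsTwinTamari (δL δR : List ℕ) : Prop :=
  IsTamariDiagram δL ∧ IsTamariDiagram δR ∧ δL.length = δR.length ∧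
  ∀ (i x y : ℕ), i + 1 < δL.length → δL[i]? = some x → δR[i]? = some y →
    ((x = 0 ∧ y ≠ 0) ∨ (x ≠ 0 ∧ y = 0))

namespace BTree

theorem length_tdiag (t : BTree) : t.tdiag.length = t.size := by
  induction t with
  | leaf => rfl
  | node l r hl hr => simp [tdiag, size, hl, hr]; omega

theorem orients_node (l r : BTree) :
    (node l r).orients = true :: (node l r).tdiag.map (fun x => decide (x ≠ 0)) := by
  have key : ∀ t : BTree, t ≠ leaf →
      t.orients = true :: t.tdiag.map (fun x => decide (x ≠ 0)) := by
    intro t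
    induction t with
    | leaf => intro h; exact absurd rfl h
    | node l r hl hr =>
      intro _
      cases l <;> cases r <;> simp_all [orients, tdiag, isLeaf, size]
  exact key _ (by simp)

/-- The canopy records which letters of the Tamari diagram, the last one excluded, are nonzero. -/
theorem canopy_eq (t : BTree) :
    t.canopy = (t.tdiag.map (fun x => decide (x ≠ 0))).dropLast := by
  cases t with
  | leaf => rfl
  | node l r => simp [canopy, orients_node]

end BTree

namespace IsTamariDiagram

theorem append_cons {a b : List ℕ} (ha : IsTamariDiagram a) (hb : IsTamariDiagram b) :
    IsTamariDiagram (a ++ b.length :: b) := by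
  have bound : ∀ (i x : ℕ), (a ++ b.length :: b)[i]? = some x →
      (i < a.length ∧ a[i]? = some x ∧ x + i + 1 ≤ a.length) ∨
      (i = a.length ∧ x = b.length) ∨
      (∃ k, i = a.length + 1 + k ∧ b[k]? = some x ∧ x + k + 1 ≤ b.length) := by
    intro i x h
    rcases lt_trichotomy i a.length with hi | hi | hi
    · rw [List.getElem?_append_left hi] at h
      exact Or.inl ⟨hi, h, ha.1 i x h⟩
    · subst hi
      simp at h
      exact Or.inr (Or.inl ⟨rfl, h.symm⟩)
    · obtain ⟨k, rfl⟩ := Nat.exists_eq_add_of_le (Nat.succ_le_of_lt hi)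
      rw [List.getElem?_append_right (by omega),
        show a.length.succ + k - a.length = k + 1 by omega, List.getElem?_cons_succ] at h
      exact Or.inr (Or.inr ⟨k, rfl, h, hb.1 k x h⟩)
  constructor
  · intro i x h
    simp only [List.length_append, List.length_cons]
    rcases bound i x h with h | h | ⟨k, h⟩ <;> omega
  · intro i j x y hx hj hjx hy
    rcases bound i x hx with ⟨hi, hx', hx⟩ | ⟨hi, hx⟩ | ⟨k, hk, hx', hx⟩ <;>
      rcases bound (i + j) y hy with ⟨hi', hy', hy⟩ | ⟨hi', hy⟩ | ⟨k', hk', hy', hy⟩ <;>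
      try omega
    · exact ha.2 i j x y hx' hj hjx hy'
    · obtain rfl : k' = k + j := by omega
      exact hb.2 k j x y hx' hj hjx hy'

/-- A nonempty Tamari diagram splits at the first position whose letter is as large as its
position allows. -/
theorem exists_eq_append_cons {δ : List ℕ} (h : IsTamariDiagram δ) (hne : δ ≠ []) :
    ∃ a b : List ℕ, δ = a ++ b.length :: b ∧ IsTamariDiagram a ∧ IsTamariDiagram b := by
  classical
  have hpos : 0 < δ.length := List.length_pos_iff.2 hne
  have hex : ∃ i x, δ[i]? = some x ∧ x + i + 1 = δ.length := by
    have hlt : δ.length - 1 < δ.length := by omega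
    have hx := List.getElem?_eq_getElem hlt
    exact ⟨_, _, hx, by have := h.1 _ _ hx; omega⟩
  set i := Nat.find hex with hi
  obtain ⟨x, hx, hxi⟩ := Nat.find_spec hex
  rw [← hi] at hx hxi
  have hmin : ∀ k y, k < i → δ[k]? = some y → y + k + 1 ≤ i := by
    intro k y hk hy
    by_contra hcon
    have h1 := h.2 k (i - k) y x hy (by omega) (by omega)
      (by rwa [show k + (i - k) = i by omega])
    have h2 := h.1 k y hy
    exact Nat.find_min hex hk ⟨y, hy, by omega⟩
  have hlt : i < δ.length := by omega
  have hget : δ[i] = x := by rw [List.getElem?_eq_getElem hlt] at hx; simpa using hx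
  have hlen : (δ.drop (i + 1)).length = x := by rw [List.length_drop]; omega
  refine ⟨δ.take i, δ.drop (i + 1), ?_, ⟨?_, ?_⟩, ⟨?_, ?_⟩⟩
  · rw [hlen, ← hget, ← List.drop_eq_getElem_cons hlt, List.take_append_drop]
  · intro k y hy
    rw [List.getElem?_take] at hy
    split_ifs at hy with hk
    have := hmin k y hk hy
    rw [List.length_take]; omega
  · intro k j y z hy hj hjy hz
    rw [List.getElem?_take] at hy hz
    split_ifs at hy hz
    exact h.2 k j y z hy hj hjy hz
  · intro k y hy
    rw [List.getElem?_drop] at hy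
    have := h.1 _ y hy
    rw [List.length_drop]; omega
  · intro k j y z hy hj hjy hz
    rw [List.getElem?_drop] at hy hz
    exact h.2 _ j y z hy hj hjy (by rwa [add_assoc])

theorem length_le_of_append_cons_eq {a b a' b' : List ℕ} (ha' : IsTamariDiagram a')
    (h : a ++ b.length :: b = a' ++ b'.length :: b') : a'.length ≤ a.length := by
  by_contra! hlt
  have hget : a'[a.length]? = some b.length := by
    rw [← List.getElem?_append_left hlt (l₂ := b'.length :: b'), ← h]
    simp
  have hlen := congrArg List.length h
  simp only [List.length_append, List.length_cons] at hlen
  have := ha'.1 _ _ hget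
  omega

end IsTamariDiagram

namespace BTree

theorem isTamariDiagram_tdiag (t : BTree) : IsTamariDiagram t.tdiag := by
  induction t with
  | leaf => constructor <;> simp [tdiag]
  | node l r hl hr =>
    rw [tdiag, ← length_tdiag]
    exact hl.append_cons hr

theorem tdiag_injective : Function.Injective tdiag := by
  intro s
  induction s with
  | leaf =>
    intro t h
    cases t with
    | leaf => rfl
    | node l r => simp [tdiag] at h
  | node l r hl hr =>
    intro t h
    cases t with
    | leaf => simp [tdiag] at h
    | node l' r' =>
      simp only [tdiag, ← length_tdiag] at h
      have hlen : l.tdiag.length = l'.tdiag.length :=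
        le_antisymm (l.isTamariDiagram_tdiag.length_le_of_append_cons_eq h.symm)
          (l'.isTamariDiagram_tdiag.length_le_of_append_cons_eq h)
      obtain ⟨h1, h2⟩ := List.append_inj h hlen
      rw [hl h1, hr (List.cons.inj h2).2]

theorem exists_tdiag_eq {δ : List ℕ} (h : IsTamariDiagram δ) : ∃ t : BTree, t.tdiag = δ := by
  by_cases hne : δ = []
  · exact ⟨leaf, hne.symm⟩
  · obtain ⟨a, b, hδ, ha, hb⟩ := h.exists_eq_append_cons hne
    have hlen := congrArg List.length hδ
    simp only [List.length_append, List.length_cons] at hlen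
    obtain ⟨l, hl⟩ := exists_tdiag_eq ha
    obtain ⟨r, hr⟩ := exists_tdiag_eq hb
    exact ⟨node l r, by rw [tdiag, ← length_tdiag, hl, hr, hδ]⟩
termination_by δ.length

end BTree

theorem twinPair_iff_isTwinTamari (L R : BTree) :
    TwinPair L R ↔ IsTwinTamari L.tdiag R.tdiag := by
  unfold TwinPair IsTwinTamari
  rw [← BTree.length_tdiag, ← BTree.length_tdiag, BTree.canopy_eq, BTree.canopy_eq]
  simp only [BTree.isTamariDiagram_tdiag, true_and]
  refine and_congr_right fun hlen => ?_
  simp only [List.getElem?_dropLast, List.getElem?_map, List.length_map, ← hlen]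
  constructor
  · intro h i x y hi hx hy
    have := h i _ _ (by rw [if_pos (by omega), hx]; rfl) (by rw [if_pos (by omega), hy]; rfl)
    by_cases hx0 : x = 0 <;> by_cases hy0 : y = 0 <;> simp_all
  · intro h i b b' hb hb'
    split_ifs at hb hb' with hi
    obtain ⟨x, hx, rfl⟩ := Option.map_eq_some_iff.1 hb
    obtain ⟨y, hy, rfl⟩ := Option.map_eq_some_iff.1 hb'
    rcases h i x y (by omega) hx hy with ⟨hx, hy⟩ | ⟨hx, hy⟩ <;> simp [hx, hy]

/-- For any `n ≥ 0`, the map `(T_L, T_R) ↦ (td(T_L), td(T_R))`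
is a bijection from the pairs of twin binary trees with `n` nodes onto the twin
Tamari diagrams of size `n`: it lands in the set of twin Tamari diagrams of size
`n`, is injective, and is surjective. -/
theorem twinPairs_biject_twinTamari (n : ℕ) :
    (∀ L R : BTree, TwinPair L R → L.size = n →
        IsTwinTamari L.tdiag R.tdiag ∧ L.tdiag.length = n) ∧
    (∀ L R L' R' : BTree, TwinPair L R → L.size = n → TwinPair L' R' → L'.size = n →
        L.tdiag = L'.tdiag → R.tdiag = R'.tdiag → L = L' ∧ R = R') ∧
    (∀ δL δR : List ℕ, IsTwinTamari δL δR → δL.length = n →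
        ∃ L R : BTree, TwinPair L R ∧ L.size = n ∧
          L.tdiag = δL ∧ R.tdiag = δR) := by
  refine ⟨fun L R h hn => ⟨(twinPair_iff_isTwinTamari L R).1 h, L.length_tdiag.trans hn⟩,
    fun L R L' R' _ _ _ _ hL hR => ⟨BTree.tdiag_injective hL, BTree.tdiag_injective hR⟩, ?_⟩
  intro δL δR h hn
  obtain ⟨L, rfl⟩ := BTree.exists_tdiag_eq h.1
  obtain ⟨R, rfl⟩ := BTree.exists_tdiag_eq h.2.1
  exact ⟨L, R, (twinPair_iff_isTwinTamari L R).2 h, L.length_tdiag.symm.trans hn, rfl, rfl⟩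
end
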